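/- arXiv:2305.14559 — 3 statements merged into one kernel-verified Lean document; each statement's English description precedes it below -/
import Mathlib

section
/- Let 𝔣 be continuous of bounded variation with ∫_𝕋 𝔣(x) dx = 0, let 𝔭(x) = e^{𝔣(x)}/(1+e^{𝔣(x)}), and let P be the Markov operator associated to the kernel p(x,·) = 𝔭(x)δ_{x+α} + 𝔮(x)δ_{x−α}. Let (x_n) ⊆ 𝕋 and let q_1 < q_2 < q_3 < ⋯ be close return times of α such that ν_{x_n,q_n}^{odd} and ν_{x_n,q_n}^{even} converge in the weak-* topology to measures ν_1 and ν_2 respectively. Then Pν_1 = ν_2, Pν_2 = ν_1, and (1/2)ν_1 + (1/2)ν_2 = μ_*, where μ_* is the unique stationary measure of the kernel. -/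
open MeasureTheory Filter Finset

noncomputable section

attribute [local instance] Classical.propDecidable

/-- The point `x + j·α` on the circle `𝕋 = ℝ/ℤ`. -/
def pt (α : ℝ) (x : UnitAddCircle) (j : ℤ) : UnitAddCircle :=
  x + (((j : ℝ) * α : ℝ) : UnitAddCircle)

/-- `𝔣` is continuous, of bounded variation, with `∫_𝕋 𝔣(z) dz = 0`. -/
def ZeroMeanBV (𝔣 : UnitAddCircle → ℝ) : Prop :=
  Continuous 𝔣 ∧ BoundedVariationOn (fun t : ℝ => 𝔣 (t : UnitAddCircle)) (Set.Icc 0 1) ∧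
    ∫ z : UnitAddCircle, 𝔣 z = 0

/-- The function `𝔭 = e^𝔣/(1+e^𝔣)` associated to `𝔣`. -/
def pOf (𝔣 : UnitAddCircle → ℝ) : UnitAddCircle → ℝ :=
  fun z => Real.exp (𝔣 z) / (1 + Real.exp (𝔣 z))

/-- `q` is a close return time of `α`: `q` is the denominator of a rational
approximation with `|α - p/q| < 1/q²`. -/
def CloseReturnTime (α : ℝ) (q : ℕ) : Prop :=
  0 < q ∧ ∃ p : ℤ, |α - (p : ℝ) / (q : ℝ)| < 1 / (q : ℝ) ^ 2

/-- The Markov operator associated to the transition kernel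
`p(x,·) = 𝔭(x) δ_{x+α} + (1-𝔭(x)) δ_{x-α}`, acting on Borel measures on the circle:
`(Pν)(A) = ∫ p(x,A) ν(dx)`. -/
def Pop (𝔭 : UnitAddCircle → ℝ) (α : ℝ) (ν : Measure UnitAddCircle) :
    Measure UnitAddCircle :=
  (ν.withDensity fun z => ENNReal.ofReal (𝔭 z)).map
      (fun z => z + ((α : ℝ) : UnitAddCircle)) +
    (ν.withDensity fun z => ENNReal.ofReal (1 - 𝔭 z)).map
      (fun z => z - ((α : ℝ) : UnitAddCircle))

/-- `μ` is the unique stationary (invariant) probability measure of the kernel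
`p(x,·) = 𝔭(x) δ_{x+α} + (1-𝔭(x)) δ_{x-α}`. -/
def IsUniqueStationary (𝔭 : UnitAddCircle → ℝ) (α : ℝ) (μ : Measure UnitAddCircle) : Prop :=
  IsProbabilityMeasure μ ∧ Pop 𝔭 α μ = μ ∧
    ∀ ν : Measure UnitAddCircle, IsProbabilityMeasure ν → Pop 𝔭 α ν = ν → ν = μ

/-- Position after `i` steps of a `±1`-walk started at `0` whose step directions are
given by `s`. -/
def posF {n : ℕ} (s : Fin n → Bool) (i : ℕ) : ℤ :=
  ∑ j ∈ Finset.univ.filter (fun j : Fin n => (j : ℕ) < i), (if s j then 1 else -1)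

/-- The probability of the `±1`-path with step directions `s` for the walk in the
environment `(𝔭, α, x)` started at `0`. -/
def pathW (𝔭 : UnitAddCircle → ℝ) (α : ℝ) (x : UnitAddCircle) {n : ℕ}
    (s : Fin n → Bool) : ℝ :=
  ∏ j : Fin n,
    (if s j then 𝔭 (pt α x (posF s (j : ℕ))) else 1 - 𝔭 (pt α x (posF s (j : ℕ))))

/-- `μ_{x,a} = Σ_{n≥1} ℙ_x(ξ_1 ≠ 0, …, ξ_{n-1} ≠ 0, ξ_n = a)`, written combinatorially
as a sum over `±1`-paths of length `n = m+1` started at `0`. -/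
def muC (𝔭 : UnitAddCircle → ℝ) (α : ℝ) (x : UnitAddCircle) (a : ℤ) : ℝ :=
  ∑' m : ℕ, ∑ s : Fin (m + 1) → Bool,
    if (∀ i, 1 ≤ i → i ≤ m → posF s i ≠ 0) ∧ posF s (m + 1) = a
    then pathW 𝔭 α x s else 0

/-- The measure `ν_{x,q}` for the given parity class: the normalized combination
`(1/M_{x,q}) Σ_{0 ≤ k < q, parity k} μ_{x,k} δ_{x+kα}`. -/
def nuMeas (𝔭 : UnitAddCircle → ℝ) (α : ℝ) (x : UnitAddCircle) (q : ℕ)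
    (parity : ℕ → Prop) : Measure UnitAddCircle :=
  (∑ k ∈ (Finset.range q).filter parity, ENNReal.ofReal (muC 𝔭 α x (k : ℤ)))⁻¹ •
    ∑ k ∈ (Finset.range q).filter parity,
      ENNReal.ofReal (muC 𝔭 α x (k : ℤ)) • Measure.dirac (pt α x (k : ℤ))

lemma posF_snoc_le {n : ℕ} (s : Fin n → Bool) (b : Bool) (i : ℕ) (hi : i ≤ n) :
    posF (Fin.snoc s b : Fin (n + 1) → Bool) i = posF s i := by
  unfold posF
  rw [Finset.sum_filter, Finset.sum_filter, Fin.sum_univ_castSucc]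
  simp only [Fin.snoc_castSucc, Fin.snoc_last, Fin.val_castSucc, Fin.val_last]
  rw [if_neg (by omega), add_zero]

lemma posF_snoc_last {n : ℕ} (s : Fin n → Bool) (b : Bool) :
    posF (Fin.snoc s b : Fin (n + 1) → Bool) (n + 1) = posF s n + (if b then 1 else -1) := by
  unfold posF
  rw [Finset.sum_filter, Finset.sum_filter, Fin.sum_univ_castSucc]
  simp only [Fin.snoc_castSucc, Fin.snoc_last, Fin.val_castSucc, Fin.val_last]
  rw [if_pos (by omega)]
  congr 1
  apply Finset.sum_congr rfl
  intro j _
  have := j.2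
  rw [if_pos (show (j : ℕ) < n + 1 by omega), if_pos (show (j : ℕ) < n by omega)]

lemma pathW_snoc (𝔭 : UnitAddCircle → ℝ) (α : ℝ) (x : UnitAddCircle) {n : ℕ}
    (s : Fin n → Bool) (b : Bool) :
    pathW 𝔭 α x (Fin.snoc s b : Fin (n + 1) → Bool) =
      pathW 𝔭 α x s * (if b then 𝔭 (pt α x (posF s n)) else 1 - 𝔭 (pt α x (posF s n))) := by
  unfold pathW
  rw [Fin.prod_univ_castSucc]
  simp only [Fin.snoc_castSucc, Fin.snoc_last, Fin.val_castSucc, Fin.val_last]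
  congr 1
  · apply Finset.prod_congr rfl
    intro j _
    rw [posF_snoc_le s b j (le_of_lt j.2)]
  · rw [posF_snoc_le s b n le_rfl]

lemma sum_snoc {n : ℕ} (F : (Fin (n + 1) → Bool) → ℝ) :
    ∑ s, F s = ∑ s : Fin n → Bool, (F (Fin.snoc s true) + F (Fin.snoc s false)) := by
  rw [← (Fin.snocEquiv (fun _ => Bool)).sum_comp, Fintype.sum_prod_type, Fintype.sum_bool,
    Finset.sum_add_distrib]
  rfl

def Aw (𝔭 : UnitAddCircle → ℝ) (α : ℝ) (x : UnitAddCircle) (m : ℕ) (a : ℤ) : ℝ :=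
  ∑ s : Fin (m + 1) → Bool,
    if (∀ i, 1 ≤ i → i ≤ m → posF s i ≠ 0) ∧ posF s (m + 1) = a
    then pathW 𝔭 α x s else 0

lemma pathW_nonneg {𝔭 : UnitAddCircle → ℝ} (h0 : ∀ z, 0 ≤ 𝔭 z) (h1 : ∀ z, 𝔭 z ≤ 1)
    (α : ℝ) (x : UnitAddCircle) {n : ℕ} (s : Fin n → Bool) : 0 ≤ pathW 𝔭 α x s := by
  unfold pathW
  apply Finset.prod_nonneg
  intro j _
  split_ifs
  · exact h0 _
  · linarith [h1 (pt α x (posF s (j : ℕ)))]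

lemma Aw_nonneg {𝔭 : UnitAddCircle → ℝ} (h0 : ∀ z, 0 ≤ 𝔭 z) (h1 : ∀ z, 𝔭 z ≤ 1)
    (α : ℝ) (x : UnitAddCircle) (m : ℕ) (a : ℤ) : 0 ≤ Aw 𝔭 α x m a := by
  unfold Aw
  apply Finset.sum_nonneg
  intro s _
  split_ifs
  · exact pathW_nonneg h0 h1 α x s
  · exact le_rfl

lemma posF_zero {n : ℕ} (s : Fin n → Bool) : posF s 0 = 0 := by
  simp [posF]

lemma Aw_zero (𝔭 : UnitAddCircle → ℝ) (α : ℝ) (x : UnitAddCircle) (a : ℤ) :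
    Aw 𝔭 α x 0 a = (if a = 1 then 𝔭 x else 0) + (if a = -1 then 1 - 𝔭 x else 0) := by
  unfold Aw
  rw [sum_snoc]
  have hpos : ∀ (s : Fin 0 → Bool) (b : Bool),
    posF (Fin.snoc s b : Fin (0 + 1) → Bool) (0 + 1) = (if b then 1 else -1) := by
    intro s b
    rw [posF_snoc_last, posF_zero, zero_add]
  have hx : pt α x 0 = x := by simp [pt]
  have hv : ∀ i : ℕ, 1 ≤ i → i ≤ 0 → False := by intro i h1 h2; omega
  simp only [hpos, pathW_snoc, posF_zero, hx]
  rw [Fintype.sum_unique]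
  have hw : ∀ s : Fin 0 → Bool, pathW 𝔭 α x s = 1 := by intro s; simp [pathW]
  simp only [hw]
  have e1 : ∀ (s : Fin (0 + 1) → Bool), (∀ i, 1 ≤ i → i ≤ 0 → posF s i ≠ 0) ↔ True := by
    intro s; constructor
    · intro _; trivial
    · intro _ i h1 h2; omega
  simp only [e1, true_and]
  simp [eq_comm]

lemma alive_snoc {m : ℕ} (s : Fin (m + 1) → Bool) (b : Bool) :
    (∀ i, 1 ≤ i → i ≤ m + 1 → posF (Fin.snoc s b : Fin (m + 1 + 1) → Bool) i ≠ 0) ↔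
    ((∀ i, 1 ≤ i → i ≤ m → posF s i ≠ 0) ∧ posF s (m + 1) ≠ 0) := by
  constructor
  · intro h
    refine ⟨fun i h1 h2 => ?_, ?_⟩
    · rw [← posF_snoc_le s b i (by omega)]; exact h i h1 (by omega)
    · rw [← posF_snoc_le s b _ le_rfl]; exact h _ (by omega) le_rfl
  · rintro ⟨h, h'⟩ i h1 h2
    rw [posF_snoc_le s b i (by omega)]
    rcases Nat.lt_or_ge m i with h3 | h3
    · have : i = m + 1 := by omega
      rw [this]; exact h'
    · exact h i h1 h3

lemma Aw_succ (𝔭 : UnitAddCircle → ℝ) (α : ℝ) (x : UnitAddCircle) (m : ℕ) (a : ℤ) :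
    Aw 𝔭 α x (m + 1) a =
      (if a - 1 = 0 then 0 else Aw 𝔭 α x m (a - 1) * 𝔭 (pt α x (a - 1))) +
      (if a + 1 = 0 then 0 else Aw 𝔭 α x m (a + 1) * (1 - 𝔭 (pt α x (a + 1)))) := by
  have h1 : Aw 𝔭 α x (m + 1) a = ∑ s : Fin (m + 1) → Bool,
      ((if a - 1 = 0 then 0 else
        (if (∀ i, 1 ≤ i → i ≤ m → posF s i ≠ 0) ∧ posF s (m + 1) = a - 1
          then pathW 𝔭 α x s else 0) * 𝔭 (pt α x (a - 1))) +
      (if a + 1 = 0 then 0 else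
        (if (∀ i, 1 ≤ i → i ≤ m → posF s i ≠ 0) ∧ posF s (m + 1) = a + 1
          then pathW 𝔭 α x s else 0) * (1 - 𝔭 (pt α x (a + 1))))) := by
    unfold Aw
    rw [sum_snoc]
    apply Finset.sum_congr rfl
    intro s _
    simp only [alive_snoc, posF_snoc_last, pathW_snoc]
    simp only [if_true, Bool.false_eq_true, if_false]
    by_cases hal : ∀ i, 1 ≤ i → i ≤ m → posF s i ≠ 0
    · congr 1
      · by_cases h2 : posF s (m + 1) = a - 1
        · rw [h2]
          by_cases h3 : a - 1 = 0
          · simp [h3]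
          · simp [h3]
        · have h2' : ¬ (posF s (m + 1) + 1 = a) := by omega
          simp [h2, h2']
      · by_cases h2 : posF s (m + 1) = a + 1
        · rw [h2]
          by_cases h3 : a + 1 = 0
          · simp [h3]
          · simp [h3]
        · have h2' : ¬ (posF s (m + 1) + -1 = a) := by omega
          simp [h2, h2']
    · simp [hal]
  rw [h1, Finset.sum_add_distrib]
  unfold Aw
  congr 1
  · split_ifs
    · simp
    · rw [Finset.sum_mul]
  · split_ifs
    · simp
    · rw [Finset.sum_mul]

def Tw (𝔭 : UnitAddCircle → ℝ) (α : ℝ) (x : UnitAddCircle) (m : ℕ) : ℝ :=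
  ∑ s : Fin (m + 1) → Bool,
    if (∀ i, 1 ≤ i → i ≤ m → posF s i ≠ 0) then pathW 𝔭 α x s else 0

lemma Tw_succ (𝔭 : UnitAddCircle → ℝ) (α : ℝ) (x : UnitAddCircle) (m : ℕ) :
    Tw 𝔭 α x (m + 1) + Aw 𝔭 α x m 0 = Tw 𝔭 α x m := by
  unfold Tw Aw
  rw [sum_snoc, ← Finset.sum_add_distrib]
  apply Finset.sum_congr rfl
  intro s _
  simp only [alive_snoc, pathW_snoc]
  by_cases hal : ∀ i, 1 ≤ i → i ≤ m → posF s i ≠ 0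
  · by_cases h2 : posF s (m + 1) = 0
    · simp [h2]
    · have hh := And.intro hal h2
      have hn : ¬ ((∀ i, 1 ≤ i → i ≤ m → posF s i ≠ 0) ∧ posF s (m + 1) = 0) := fun h => h2 h.2
      simp only [ne_eq] at hh hn hal ⊢
      simp only [if_true, Bool.false_eq_true, if_false, if_pos hh, if_neg hn, if_pos hal]; ring
  · simp [hal]

lemma Tw_nonneg {𝔭 : UnitAddCircle → ℝ} (h0 : ∀ z, 0 ≤ 𝔭 z) (h1 : ∀ z, 𝔭 z ≤ 1)
    (α : ℝ) (x : UnitAddCircle) (m : ℕ) : 0 ≤ Tw 𝔭 α x m := by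
  unfold Tw
  apply Finset.sum_nonneg
  intro s _
  split_ifs
  · exact pathW_nonneg h0 h1 α x s
  · exact le_rfl

lemma Tw_zero (𝔭 : UnitAddCircle → ℝ) (α : ℝ) (x : UnitAddCircle) : Tw 𝔭 α x 0 = 1 := by
  unfold Tw
  rw [sum_snoc, Fintype.sum_unique]
  have e1 : ∀ (s : Fin (0 + 1) → Bool), (∀ i, 1 ≤ i → i ≤ 0 → posF s i ≠ 0) ↔ True := by
    intro s; constructor
    · intro _; trivial
    · intro _ i h1 h2; omega
  simp only [e1, pathW_snoc]
  have hw : ∀ s : Fin 0 → Bool, pathW 𝔭 α x s = 1 := by intro s; simp [pathW]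
  simp only [hw]; simp

lemma muC_zero_le {𝔭 : UnitAddCircle → ℝ} (h0 : ∀ z, 0 ≤ 𝔭 z) (h1 : ∀ z, 𝔭 z ≤ 1)
    (α : ℝ) (x : UnitAddCircle) : muC 𝔭 α x 0 ≤ 1 := by
  have hs : ∀ N, ∑ m ∈ range N, Aw 𝔭 α x m 0 = 1 - Tw 𝔭 α x N := by
    intro N
    induction N with
    | zero => simp [Tw_zero]
    | succ N ih => rw [Finset.sum_range_succ, ih]; linarith [Tw_succ 𝔭 α x N]
  change ∑' m, Aw 𝔭 α x m 0 ≤ 1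
  apply Real.tsum_le_of_sum_range_le (fun m => Aw_nonneg h0 h1 α x m 0)
  intro N
  rw [hs]; linarith [Tw_nonneg h0 h1 α x N]

lemma muC_nonneg {𝔭 : UnitAddCircle → ℝ} (h0 : ∀ z, 0 ≤ 𝔭 z) (h1 : ∀ z, 𝔭 z ≤ 1)
    (α : ℝ) (x : UnitAddCircle) (a : ℤ) : 0 ≤ muC 𝔭 α x a :=
  tsum_nonneg (fun m => Aw_nonneg h0 h1 α x m a)

lemma evar_shift (F : ℝ → ℝ) (hF : ∀ t, F (t + 1) = F t) (a b : ℝ) :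
    eVariationOn F (Set.Icc (a + 1) (b + 1)) = eVariationOn F (Set.Icc a b) := by
  have h := eVariationOn.comp_eq_of_monotoneOn F (t := Set.Icc a b) (fun t => t + 1)
    (by intro u _ v _ huv; simpa using huv)
  rw [Set.image_add_const_Icc] at h
  rw [← h]
  apply eVariationOn.congr
  intro t _
  exact hF t

lemma evar_fin (F : ℝ → ℝ) (hF : ∀ t, F (t + 1) = F t)
    (h : BoundedVariationOn F (Set.Icc 0 1)) :
    eVariationOn F (Set.Icc (-1) 2) ≠ ⊤ := by
  have h0 : eVariationOn F (Set.Icc 0 1) ≠ ⊤ := h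
  have h1 : eVariationOn F (Set.Icc 1 2) = eVariationOn F (Set.Icc 0 1) := by
    have := evar_shift F hF 0 1
    norm_num at this; exact this
  have h2 : eVariationOn F (Set.Icc (-1) 0) = eVariationOn F (Set.Icc 0 1) := by
    have := evar_shift F hF (-1) 0
    norm_num at this; exact this.symm
  have h3 := eVariationOn.Icc_add_Icc F (s := Set.univ) (a := -1) (b := 0) (c := 1)
    (by norm_num) (by norm_num) trivial
  have h4 := eVariationOn.Icc_add_Icc F (s := Set.univ) (a := -1) (b := 1) (c := 2)
    (by norm_num) (by norm_num) trivial
  simp only [Set.univ_inter] at h3 h4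
  rw [← h4, ← h3, h1, h2]
  simp [h0]

lemma residue_sum (q : ℕ) (hq : 0 < q) (p : ℤ) (hpq : IsCoprime p (q : ℤ)) (H : ℕ → ℝ) :
    ∑ k ∈ range q, H (((k : ℤ) * p) % (q : ℤ)).toNat = ∑ j ∈ range q, H j := by
  have hq' : (0 : ℤ) < q := by exact_mod_cast hq
  have hmaps : Set.MapsTo (fun k : ℕ => (((k : ℤ) * p) % (q : ℤ)).toNat)
      (range q : Set ℕ) (range q : Set ℕ) := by
    intro k _
    have h1 := Int.emod_nonneg ((k : ℤ) * p) hq'.ne'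
    have h2 := Int.emod_lt_of_pos ((k : ℤ) * p) hq'
    simp only [Finset.coe_range, Set.mem_Iio]
    omega
  have hinj : Set.InjOn (fun k : ℕ => (((k : ℤ) * p) % (q : ℤ)).toNat) (range q : Set ℕ) := by
    intro k hk l hl hkl
    simp only [Finset.coe_range, Set.mem_Iio] at hk hl
    have h1 := Int.emod_nonneg ((k : ℤ) * p) hq'.ne'
    have h2 := Int.emod_nonneg ((l : ℤ) * p) hq'.ne'
    have h3 : ((k : ℤ) * p) % (q : ℤ) = ((l : ℤ) * p) % (q : ℤ) := by
      simp only at hkl; omega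
    have h4 : (q : ℤ) ∣ ((l : ℤ) - k) * p := by
      have := (Int.emod_emod_of_dvd ((k : ℤ) * p) (dvd_refl (q : ℤ)))
      have h5 : (k : ℤ) * p ≡ (l : ℤ) * p [ZMOD q] := h3
      rw [sub_mul]
      exact h5.dvd
    have h6 : (q : ℤ) ∣ ((l : ℤ) - k) := (hpq.symm).dvd_of_dvd_mul_right h4
    have h7 : ((l : ℤ) - k) = 0 := by
      apply Int.eq_zero_of_abs_lt_dvd h6
      rw [abs_lt]; constructor <;> omega
    omega
  refine Finset.sum_nbij (fun k : ℕ => (((k : ℤ) * p) % (q : ℤ)).toNat) hmaps hinj ?_ ?_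
  · exact Finset.surjOn_of_injOn_of_card_le _ hmaps hinj le_rfl
  · intro k _; rfl

lemma int_coe_zero (n : ℤ) : (((n : ℝ)) : UnitAddCircle) = 0 := by
  rw [AddCircle.coe_eq_zero_iff]
  exact ⟨n, by simp⟩

lemma DK (𝔣 : UnitAddCircle → ℝ) (h𝔣 : ZeroMeanBV 𝔣) (α : ℝ) :
    ∃ C : ℝ, ∀ (q : ℕ) (p : ℤ), 0 < q → IsCoprime p (q : ℤ) →
      |α - (p : ℝ) / (q : ℝ)| < 1 / (q : ℝ) ^ 2 →
      ∀ y : UnitAddCircle, |∑ k ∈ range q, 𝔣 (pt α y (k : ℤ))| ≤ C := by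
  obtain ⟨hc, hbv, hint⟩ := h𝔣
  set F : ℝ → ℝ := fun t : ℝ => 𝔣 (t : UnitAddCircle) with hFdef
  have hF : ∀ t, F (t + 1) = F t := by
    intro t
    have h1 := int_coe_zero 1
    simp only [hFdef]
    rw [AddCircle.coe_add]
    simp only [Int.cast_one] at h1
    rw [h1, add_zero]
  have hW := evar_fin F hF hbv
  set W := eVariationOn F (Set.Icc (-1) 2) with hWdef
  refine ⟨(2 * W).toReal, ?_⟩
  intro q p hq hpq hα y
  have hqR : (0 : ℝ) < q := by exact_mod_cast hq
  obtain ⟨y0, hy0, rfl⟩ : ∃ y0 : ℝ, y0 ∈ Set.Ico (0 : ℝ) 1 ∧ (y0 : UnitAddCircle) = y := by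
    refine ⟨(AddCircle.equivIco 1 0 y : ℝ), ?_, ?_⟩
    · have := (AddCircle.equivIco 1 0 y).2
      simpa using this
    · exact (AddCircle.equivIco 1 0).symm_apply_apply y
  -- the averaged function
  set g : UnitAddCircle → ℝ := fun z => ∑ j ∈ range q, 𝔣 (z + (((j : ℝ) / q : ℝ) : UnitAddCircle))
    with hg
  have hgc : Continuous g := by
    simp only [hg]; fun_prop
  have hgi : Integrable g := hgc.integrable_of_hasCompactSupport (HasCompactSupport.of_compactSpace g)
  have hg0 : ∫ z, g z = 0 := by
    simp only [hg]
    rw [integral_finsetSum]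
    · apply Finset.sum_eq_zero
      intro j _
      rw [integral_add_right_eq_self (μ := (volume : Measure UnitAddCircle)) 𝔣]
      exact hint
    · intro j _
      exact Continuous.integrable_of_hasCompactSupport (by fun_prop)
        (HasCompactSupport.of_compactSpace _)
  have hgper : ∀ z, g (z + ((1 / q : ℝ) : UnitAddCircle)) = g z := by
    intro z
    have h1 : ∀ j : ℕ, z + ((1 / q : ℝ) : UnitAddCircle) + (((j : ℝ) / q : ℝ) : UnitAddCircle)
        = z + ((((j + 1 : ℕ) : ℝ) / q : ℝ) : UnitAddCircle) := by
      intro j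
      rw [add_assoc, ← AddCircle.coe_add]
      congr 2
      push_cast; ring
    simp only [hg, h1]
    have h2 := Finset.sum_range_succ (fun j : ℕ => 𝔣 (z + (((j : ℝ) / q : ℝ) : UnitAddCircle))) q
    have h3 := Finset.sum_range_succ' (fun j : ℕ => 𝔣 (z + (((j : ℝ) / q : ℝ) : UnitAddCircle))) q
    have h4 : (((q : ℝ) / q : ℝ) : UnitAddCircle) = 0 := by
      rw [div_self hqR.ne']
      simpa using int_coe_zero 1
    rw [h4] at h2
    rw [h2] at h3
    simp only [Nat.cast_zero, zero_div, AddCircle.coe_zero] at h3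
    linarith
  have hgper' : ∀ (i : ℕ) z, g (z + ((i / q : ℝ) : UnitAddCircle)) = g z := by
    intro i
    induction i with
    | zero => intro z; simp
    | succ i ih =>
      intro z
      rw [← ih z, ← hgper (z + ((i / q : ℝ) : UnitAddCircle)), add_assoc, ← AddCircle.coe_add]
      congr 3
      push_cast; ring
  have hred : ∀ z, ∃ t : ℝ, 0 ≤ t ∧ t ≤ 1 / q ∧ g z = g ((y0 + t : ℝ) : UnitAddCircle) := by
    intro z
    obtain ⟨s, hs, hsz⟩ : ∃ s : ℝ, s ∈ Set.Ico (0 : ℝ) 1 ∧ (s : UnitAddCircle) = z - (y0 : UnitAddCircle) := by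
      refine ⟨(AddCircle.equivIco 1 0 (z - (y0 : UnitAddCircle)) : ℝ), ?_, ?_⟩
      · have := (AddCircle.equivIco 1 0 (z - (y0 : UnitAddCircle))).2
        simpa using this
      · exact (AddCircle.equivIco 1 0).symm_apply_apply (z - (y0 : UnitAddCircle))
    have hf1 := Nat.floor_le (mul_nonneg hs.1 hqR.le)
    have hf2 := (Nat.lt_floor_add_one (s * q)).le
    refine ⟨s - ⌊s * q⌋₊ / q, ?_, ?_, ?_⟩
    · rw [sub_nonneg, div_le_iff₀ hqR]; exact hf1
    · rw [sub_le_iff_le_add, ← add_div, le_div_iff₀ hqR]; linarith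
    · rw [← hgper' ⌊s * q⌋₊ ((y0 + _ : ℝ) : UnitAddCircle), ← AddCircle.coe_add]
      have : y0 + (s - (⌊s * q⌋₊ : ℝ) / q) + (⌊s * q⌋₊ : ℝ) / q = y0 + s := by ring
      rw [this, AddCircle.coe_add, hsz]
      congr 1
      abel
  -- the comparison
  have hmain : ∀ t : ℝ, 0 ≤ t → t ≤ 1 / q →
      |∑ k ∈ range q, 𝔣 (pt α y0 (k : ℤ)) - g ((y0 + t : ℝ) : UnitAddCircle)| ≤ (2 * W).toReal := by
    intro t ht0 ht1
    set I : ℕ → ℝ := fun i => y0 + ((i : ℝ) - 1) / q with hI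
    have hImono : Monotone I := by
      intro i j hij
      simp only [hI]
      have : (i : ℝ) ≤ j := by exact_mod_cast hij
      gcongr
    set e : ℕ → ENNReal := fun i => eVariationOn F (Set.Icc (I i) (I (i + 1))) with he
    have hq1 : 1 / (q : ℝ) ≤ 1 := by
      rw [div_le_one hqR]; exact_mod_cast hq
    have hesum1 : ∑ i ∈ range q, e i ≤ W := by
      rw [he, eVariationOn.sum' F hImono]
      apply eVariationOn.mono
      apply Set.Icc_subset_Icc
      · simp only [hI, Nat.cast_zero, zero_sub, neg_div]; linarith [hy0.1]
      · simp only [hI, sub_div, div_self hqR.ne']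
        have := one_div_pos.2 hqR
        linarith [hy0.2]
    have hesum2 : ∑ i ∈ range q, e (i + 1) ≤ W := by
      have := eVariationOn.sum' F (I := fun i => I (i + 1))
        (fun i j hij => hImono (by omega)) (n := q)
      simp only [he]
      rw [this]
      apply eVariationOn.mono
      apply Set.Icc_subset_Icc
      · simp [hI]; linarith [hy0.1]
      · simp [hI, div_self hqR.ne']
        linarith [hy0.2]
    have hetot : ∑ i ∈ range q, (e i + e (i + 1)) ≤ 2 * W := by
      rw [Finset.sum_add_distrib, two_mul]; exact add_le_add hesum1 hesum2
    have h2W : 2 * W ≠ ⊤ := ENNReal.mul_ne_top (by simp) hW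
    have hefin : ∀ i ∈ range q, e i + e (i + 1) ≠ ⊤ := by
      intro i hi
      exact ne_top_of_le_ne_top h2W
        ((Finset.single_le_sum (f := fun i => e i + e (i + 1)) (fun _ _ => zero_le) hi).trans hetot)
    have hcombine : ∀ j ∈ range q, ∀ a b, I j ≤ a → a ≤ I (j + 2) → I j ≤ b → b ≤ I (j + 2) →
        |F a - F b| ≤ (e j + e (j + 1)).toReal := by
      intro j hj a b ha1 ha2 hb1 hb2
      have h1 := eVariationOn.edist_le F (s := Set.Icc (I j) (I (j + 2)))
        (x := a) (y := b) ⟨ha1, ha2⟩ ⟨hb1, hb2⟩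
      have h2 := eVariationOn.Icc_add_Icc F (s := Set.univ) (hImono (Nat.le_succ j))
        (hImono (Nat.le_succ (j + 1))) trivial
      simp only [Set.univ_inter] at h2
      rw [← h2] at h1
      have h3 := ENNReal.toReal_mono (hefin j hj) h1
      rwa [edist_dist, ENNReal.toReal_ofReal dist_nonneg, Real.dist_eq] at h3
    set r : ℕ → ℕ := fun k => (((k : ℤ) * p) % (q : ℤ)).toNat with hr
    have hg' : g ((y0 + t : ℝ) : UnitAddCircle) = ∑ k ∈ range q, F (y0 + r k / q + t) := by
      rw [residue_sum q hq p hpq (fun j => F (y0 + j / q + t))]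
      simp only [hg, hFdef]
      apply Finset.sum_congr rfl
      intro j _
      rw [← AddCircle.coe_add]
      congr 2; ring
    rw [hg', ← Finset.sum_sub_distrib]
    refine (Finset.abs_sum_le_sum_abs _ _).trans ?_
    have hbd : ∀ k ∈ range q, |𝔣 (pt α y0 (k : ℤ)) - F (y0 + r k / q + t)| ≤
        (e (r k) + e (r k + 1)).toReal := by
      intro k hk
      have hq' : (0 : ℤ) < q := by exact_mod_cast hq
      have h1 := Int.emod_nonneg ((k : ℤ) * p) hq'.ne'
      have h2 := Int.emod_lt_of_pos ((k : ℤ) * p) hq'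
      have hrk : (r k : ℤ) = ((k : ℤ) * p) % (q : ℤ) := by
        simp only [hr]; exact Int.toNat_of_nonneg h1
      have hrq : r k ∈ range q := by
        rw [Finset.mem_range]; omega
      have hdiv := Int.emod_add_mul_ediv ((k : ℤ) * p) q
      rw [← hrk] at hdiv
      have hdivR : (r k : ℝ) + q * (((k : ℤ) * p / q : ℤ) : ℝ) = k * p := by exact_mod_cast hdiv
      set δ : ℝ := k * (α - p / q) with hδ
      have hkq : (k : ℝ) < q := by exact_mod_cast Finset.mem_range.1 hk
      have hδ1 : |δ| ≤ 1 / q := by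
        rw [hδ, abs_mul, abs_of_nonneg (Nat.cast_nonneg k : (0 : ℝ) ≤ k)]
        calc (k : ℝ) * |α - p / q| ≤ q * (1 / (q : ℝ) ^ 2) := by
              apply mul_le_mul hkq.le hα.le (abs_nonneg _) hqR.le
          _ = 1 / q := by field_simp
      have hpt : 𝔣 (pt α y0 (k : ℤ)) = F (y0 + r k / q + δ) := by
        simp only [hFdef, pt]
        congr 1
        have : (((k : ℤ) : ℝ) * α) = (r k / q + δ) + (((k : ℤ) * p / q : ℤ) : ℝ) := by
          have : (((k : ℤ) * p / q : ℤ) : ℝ) = (k * p - r k) / q := by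
            rw [eq_div_iff hqR.ne']; linarith
          rw [this, hδ]; push_cast; field_simp; ring
        rw [this, AddCircle.coe_add _ (r k / q + δ), int_coe_zero, add_zero, ← AddCircle.coe_add]
        congr 1; ring
      rw [hpt]
      have hδ2 := abs_le.1 hδ1
      have e1 : I (r k) = y0 + r k / q - 1 / q := by simp only [hI]; ring
      have e2 : I (r k + 2) = y0 + r k / q + 1 / q := by simp only [hI]; push_cast; ring
      have hp := one_div_pos.2 hqR
      apply hcombine _ hrq
      · rw [e1]; linarith
      · rw [e2]; linarith
      · rw [e1]; linarith
      · rw [e2]; linarith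
    refine (Finset.sum_le_sum hbd).trans ?_
    rw [residue_sum q hq p hpq (fun j => (e j + e (j + 1)).toReal), ← ENNReal.toReal_sum hefin]
    exact ENNReal.toReal_mono h2W hetot
  have : IsProbabilityMeasure (volume : Measure UnitAddCircle) := ⟨UnitAddCircle.measure_univ⟩
  obtain ⟨z1, hz1⟩ := exists_le_integral hgi
  obtain ⟨z2, hz2⟩ := exists_integral_le hgi
  rw [hg0] at hz1 hz2
  obtain ⟨t1, a1, a2, a3⟩ := hred z1
  obtain ⟨t2, b1, b2, b3⟩ := hred z2
  have m1 := abs_le.1 (hmain t1 a1 a2)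
  have m2 := abs_le.1 (hmain t2 b1 b2)
  rw [← a3] at m1
  rw [← b3] at m2
  rw [abs_le]
  constructor <;> linarith

lemma dens_infinite (α : ℝ) (hα : Irrational α) :
    (Rat.den '' {r : ℚ | |α - r| < 1 / (r.den : ℝ) ^ 2}).Infinite := by
  intro hfin
  apply Real.infinite_rat_abs_sub_lt_one_div_den_sq_of_irrational hα
  have hfib : ∀ d : ℕ, ({r : ℚ | |α - r| < 1 / (r.den : ℝ) ^ 2} ∩ {r | r.den = d}).Finite := by
    intro d
    have hinj : Set.InjOn Rat.num
        ({r : ℚ | |α - r| < 1 / (r.den : ℝ) ^ 2} ∩ {r | r.den = d}) := by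
      intro r hr s hs hrs
      exact Rat.ext hrs (hr.2.trans hs.2.symm)
    refine Set.Finite.of_finite_image ?_ hinj
    apply (Set.finite_Icc (⌊(d : ℝ) * (α - 1)⌋) (⌈(d : ℝ) * (α + 1)⌉)).subset
    rintro _ ⟨r, ⟨hr, hrd⟩, rfl⟩
    simp only [Set.mem_ofPred_eq] at hr hrd
    have hd : (1 : ℝ) ≤ r.den := by exact_mod_cast r.den_pos
    have h1 : 1 / (r.den : ℝ) ^ 2 ≤ 1 := by
      rw [div_le_one (by positivity)]; nlinarith
    have h2 := abs_lt.1 (hr.trans_le h1)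
    have h3 : (r : ℝ) * r.den = r.num := by exact_mod_cast Rat.mul_den_eq_num r
    rw [← hrd]
    constructor
    · have : (⌊(r.den : ℝ) * (α - 1)⌋ : ℝ) ≤ r.num := by
        refine (Int.floor_le _).trans ?_
        rw [← h3]; nlinarith
      exact_mod_cast this
    · have : (r.num : ℝ) ≤ ⌈(r.den : ℝ) * (α + 1)⌉ := by
        refine le_trans ?_ (Int.le_ceil _)
        rw [← h3]; nlinarith
      exact_mod_cast this
  refine (hfin.biUnion (t := fun d => {r : ℚ | |α - r| < 1 / (r.den : ℝ) ^ 2} ∩ {r | r.den = d})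
    (fun d _ => hfib d)).subset ?_
  intro r hr
  simp only [Set.mem_iUnion]
  exact ⟨r.den, ⟨r, hr, rfl⟩, hr, rfl⟩

lemma good_times (𝔣 : UnitAddCircle → ℝ) (h𝔣 : ZeroMeanBV 𝔣) (α : ℝ) (hα : Irrational α) :
    ∃ C : ℝ, ∀ L : ℕ, ∃ G : Finset ℕ, G.card = L ∧ ∀ k ∈ G, 1 ≤ k ∧
      ∀ y : UnitAddCircle, |∑ j ∈ range k, 𝔣 (pt α y (j : ℤ))| ≤ C := by
  obtain ⟨C, hC⟩ := DK 𝔣 h𝔣 α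
  refine ⟨C, fun L => ?_⟩
  obtain ⟨G, hG, hL⟩ := (dens_infinite α hα).exists_subset_card_eq L
  refine ⟨G, hL, fun k hk => ?_⟩
  obtain ⟨r, hr, rfl⟩ := hG hk
  refine ⟨r.den_pos, hC r.den r.num r.den_pos ?_ ?_⟩
  · rw [Int.isCoprime_iff_gcd_eq_one]
    have := r.reduced
    simpa [Int.gcd, Nat.Coprime] using this
  · have h : (r : ℝ) = (r.num : ℝ) / r.den := by exact Rat.cast_def r
    rw [← h]; exact hr

lemma recur_abs (A : ℕ → ℕ → ℝ) (hA : ∀ m a, 0 ≤ A m a) (pr w : ℕ → ℝ)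
    (hp0 : ∀ k, 0 < pr k) (hp1 : ∀ k, pr k < 1) (hw : ∀ k, 0 < w k) (hw0 : w 0 = 1)
    (hbal : ∀ k, w k * pr k = w (k + 1) * (1 - pr (k + 1)))
    (h01 : A 0 1 = pr 0) (h0 : ∀ a, A 0 (a + 2) = 0)
    (h1 : ∀ m, A (m + 1) 1 = A m 2 * (1 - pr 2))
    (h2 : ∀ m a, A (m + 1) (a + 2) = A m (a + 1) * pr (a + 1) + A m (a + 3) * (1 - pr (a + 3)))
    (hdiv : ∀ K : ℝ, ∃ N : ℕ, K ≤ ∑ i ∈ range N, 1 / (w i * pr i)) :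
    ∀ a, ∑' m, A m (a + 1) = w (a + 1) := by
  have hU : ∀ N a, ∑ m ∈ range N, A m (a + 1) ≤ w (a + 1) := by
    intro N
    induction N with
    | zero => intro a; simpa using (hw _).le
    | succ N ih =>
      intro a
      rw [Finset.sum_range_succ']
      rcases a with _ | a
      · simp only [zero_add, h1, h01]
        rw [← Finset.sum_mul]
        have e1 := hbal 0
        have e2 := hbal 1
        have e3 := mul_le_mul_of_nonneg_right (ih 1) (sub_pos.2 (hp1 2)).le
        norm_num at e1 e2 e3
        rw [hw0] at e1
        linarith
      · have e0 : ∀ m, A (m + 1) (a + 1 + 1) = _ := fun m => h2 m a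
        have e00 : A 0 (a + 1 + 1) = 0 := h0 a
        simp only [e0, e00]
        rw [Finset.sum_add_distrib, ← Finset.sum_mul, ← Finset.sum_mul]
        have e1 := hbal (a + 1)
        have e2 := hbal (a + 2)
        have e3 := mul_le_mul_of_nonneg_right (ih (a + 2)) (sub_pos.2 (hp1 (a + 3))).le
        have e4 := mul_le_mul_of_nonneg_right (ih a) (hp0 (a + 1)).le
        simp only [add_assoc] at *
        norm_num at *
        linarith
  have hS : ∀ a, Summable (fun m => A m (a + 1)) := fun a =>
    summable_of_sum_range_le (fun m => hA m _) (fun N => hU N a)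
  set μ : ℕ → ℝ := fun a => if a = 0 then 1 else ∑' m, A m a with hμ
  have hμ0 : μ 0 = 1 := by simp [hμ]
  have hμs : ∀ a, μ (a + 1) = ∑' m, A m (a + 1) := by intro a; simp [hμ]
  have hμn : ∀ a, 0 ≤ μ a := by
    intro a
    rcases a with _ | a
    · rw [hμ0]; norm_num
    · rw [hμs]; exact tsum_nonneg (fun m => hA m _)
  have hle : μ 1 ≤ w 1 := by
    rw [hμs 0]
    exact Real.tsum_le_of_sum_range_le (fun m => hA m _) (fun N => hU N 0)
  have f1 : μ 1 = pr 0 + μ 2 * (1 - pr 2) := by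
    rw [hμs 0, hμs 1, (hS 0).tsum_eq_zero_add]
    simp only [zero_add, h01, h1]
    rw [tsum_mul_right]
  have f2 : ∀ a, μ (a + 2) = μ (a + 1) * pr (a + 1) + μ (a + 3) * (1 - pr (a + 3)) := by
    intro a
    rw [hμs (a + 1), hμs a, hμs (a + 2), (hS (a + 1)).tsum_eq_zero_add]
    have e0 : ∀ m, A (m + 1) (a + 1 + 1) = _ := fun m => h2 m a
    have e00 : A 0 (a + 1 + 1) = 0 := h0 a
    simp only [e0, e00]
    rw [zero_add, Summable.tsum_add ((hS a).mul_right _) ((hS (a + 2)).mul_right _),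
      tsum_mul_right, tsum_mul_right]
  set J : ℝ := pr 0 - μ 1 * (1 - pr 1) with hJ
  have hflow : ∀ a, μ a * pr a - μ (a + 1) * (1 - pr (a + 1)) = J := by
    intro a
    induction a with
    | zero => rw [hμ0, hJ]; simp
    | succ a ih =>
      rcases a with _ | a
      · norm_num at *; linarith
      · have := f2 a
        simp only [add_assoc] at *
        norm_num at *
        linarith
  have hg : ∀ N, μ N / w N = 1 - J * ∑ i ∈ range N, 1 / (w i * pr i) := by
    intro N
    induction N with
    | zero => simp [hμ0, hw0]
    | succ N ih =>
      rw [Finset.sum_range_succ, mul_add, ← sub_sub, ← ih, ← hflow N]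
      have hb := hbal N
      have a1 := (hw N).ne'
      have a2 := (hw (N + 1)).ne'
      have a3 := (hp0 N).ne'
      have a4 := (sub_pos.2 (hp1 (N + 1))).ne'
      rw [hb]
      have e : μ N / w N = μ N * pr N / (w (N + 1) * (1 - pr (N + 1))) := by
        rw [← hb]; field_simp
      rw [e]
      field_simp
      ring
  have hJ0 : 0 ≤ J := by
    have := mul_le_mul_of_nonneg_right hle (sub_pos.2 (hp1 1)).le
    have e1 := hbal 0
    norm_num at e1
    rw [hw0] at e1
    rw [hJ]; linarith
  have hJz : J = 0 := by
    by_contra hne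
    have hpos : 0 < J := lt_of_le_of_ne hJ0 (Ne.symm hne)
    obtain ⟨N, hN⟩ := hdiv (2 / J)
    have e1 := hg N
    have e2 : 0 ≤ μ N / w N := div_nonneg (hμn N) (hw N).le
    have e3 := mul_le_mul_of_nonneg_left hN hJ0
    rw [mul_div_cancel₀ _ hne] at e3
    linarith
  intro a
  have e := hg (a + 1)
  rw [hJz, zero_mul, sub_zero, div_eq_one_iff_eq (hw _).ne'] at e
  rw [← hμs, e]

def cE (𝔣 : UnitAddCircle → ℝ) (α : ℝ) (x : UnitAddCircle) (k : ℕ) : ℝ :=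
  (1 - pOf 𝔣 x) * Real.exp (∑ j ∈ range (k + 1), 𝔣 (pt α x (j : ℤ)))

def wE (𝔣 : UnitAddCircle → ℝ) (α : ℝ) (x : UnitAddCircle) (k : ℕ) : ℝ :=
  cE 𝔣 α x k / pOf 𝔣 (pt α x (k : ℤ))

lemma pOf_pos (𝔣 : UnitAddCircle → ℝ) (z : UnitAddCircle) : 0 < pOf 𝔣 z := by
  unfold pOf; positivity

lemma one_sub_pOf (𝔣 : UnitAddCircle → ℝ) (z : UnitAddCircle) :
    1 - pOf 𝔣 z = 1 / (1 + Real.exp (𝔣 z)) := by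
  unfold pOf
  have := Real.exp_pos (𝔣 z)
  field_simp; ring

lemma pOf_lt (𝔣 : UnitAddCircle → ℝ) (z : UnitAddCircle) : pOf 𝔣 z < 1 := by
  have h := one_sub_pOf 𝔣 z
  have : 0 < 1 / (1 + Real.exp (𝔣 z)) := by positivity
  linarith

lemma pOf_bal (𝔣 : UnitAddCircle → ℝ) (z : UnitAddCircle) :
    pOf 𝔣 z = (1 - pOf 𝔣 z) * Real.exp (𝔣 z) := by
  rw [one_sub_pOf]; unfold pOf; ring

lemma pt_zero (α : ℝ) (x : UnitAddCircle) : pt α x 0 = x := by simp [pt]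

lemma pt_add (α : ℝ) (x : UnitAddCircle) (i j : ℤ) : pt α (pt α x i) j = pt α x (i + j) := by
  simp only [pt]
  rw [add_assoc, ← AddCircle.coe_add]
  congr 2; push_cast; ring

lemma cE_pos (𝔣 : UnitAddCircle → ℝ) (α : ℝ) (x : UnitAddCircle) (k : ℕ) : 0 < cE 𝔣 α x k :=
  mul_pos (sub_pos.2 (pOf_lt 𝔣 x)) (Real.exp_pos _)

lemma wE_pos (𝔣 : UnitAddCircle → ℝ) (α : ℝ) (x : UnitAddCircle) (k : ℕ) : 0 < wE 𝔣 α x k :=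
  div_pos (cE_pos 𝔣 α x k) (pOf_pos _ _)

lemma wE_mul (𝔣 : UnitAddCircle → ℝ) (α : ℝ) (x : UnitAddCircle) (k : ℕ) :
    wE 𝔣 α x k * pOf 𝔣 (pt α x (k : ℤ)) = cE 𝔣 α x k :=
  div_mul_cancel₀ _ (pOf_pos _ _).ne'

lemma wE_succ_mul (𝔣 : UnitAddCircle → ℝ) (α : ℝ) (x : UnitAddCircle) (k : ℕ) :
    wE 𝔣 α x (k + 1) * (1 - pOf 𝔣 (pt α x ((k + 1 : ℕ) : ℤ))) = cE 𝔣 α x k := by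
  have h1 : cE 𝔣 α x (k + 1) = cE 𝔣 α x k * Real.exp (𝔣 (pt α x ((k + 1 : ℕ) : ℤ))) := by
    unfold cE
    rw [Finset.sum_range_succ _ (k + 1), Real.exp_add, mul_assoc]
  have h2 := pOf_bal 𝔣 (pt α x ((k + 1 : ℕ) : ℤ))
  have h3 := (pOf_pos 𝔣 (pt α x ((k + 1 : ℕ) : ℤ))).ne'
  have h4 := Real.exp_pos (𝔣 (pt α x ((k + 1 : ℕ) : ℤ)))
  unfold wE
  rw [h1, div_mul_eq_mul_div, div_eq_iff h3]
  nth_rewrite 2 [h2]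
  ring

lemma wE_zero (𝔣 : UnitAddCircle → ℝ) (α : ℝ) (x : UnitAddCircle) : wE 𝔣 α x 0 = 1 := by
  unfold wE cE
  simp only [zero_add, Finset.sum_range_one, Nat.cast_zero, pt_zero]
  rw [← pOf_bal, div_self (pOf_pos 𝔣 x).ne']

lemma muC_eq (𝔣 : UnitAddCircle → ℝ) (h𝔣 : ZeroMeanBV 𝔣) (α : ℝ) (hα : Irrational α)
    (x : UnitAddCircle) (k : ℕ) :
    muC (pOf 𝔣) α x ((k + 1 : ℕ) : ℤ) = wE 𝔣 α x (k + 1) := by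
  have hn0 : ∀ z, 0 ≤ pOf 𝔣 z := fun z => (pOf_pos 𝔣 z).le
  have hn1 : ∀ z, pOf 𝔣 z ≤ 1 := fun z => (pOf_lt 𝔣 z).le
  refine recur_abs (fun m a => Aw (pOf 𝔣) α x m (a : ℤ)) (fun m a => Aw_nonneg hn0 hn1 α x m a)
    (fun k => pOf 𝔣 (pt α x (k : ℤ))) (wE 𝔣 α x) (fun k => pOf_pos _ _) (fun k => pOf_lt _ _)
    (wE_pos 𝔣 α x) (wE_zero 𝔣 α x) ?_ ?_ ?_ ?_ ?_ ?_ k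
  · intro k
    rw [wE_mul, wE_succ_mul]
  · simp [Aw_zero, pt_zero]
  · intro a
    rw [Aw_zero, if_neg (by push_cast; omega), if_neg (by push_cast; omega), add_zero]
  · intro m
    rw [Aw_succ]
    simp
  · intro m a
    rw [Aw_succ, if_neg (by push_cast; omega), if_neg (by push_cast; omega)]
    have e1 : ((a + 2 : ℕ) : ℤ) - 1 = ((a + 1 : ℕ) : ℤ) := by push_cast; ring
    have e2 : ((a + 2 : ℕ) : ℤ) + 1 = ((a + 3 : ℕ) : ℤ) := by push_cast; ring
    rw [e1, e2]
  · intro K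
    obtain ⟨C, hC⟩ := good_times 𝔣 h𝔣 α hα
    obtain ⟨L, hL⟩ := exists_nat_ge (K / Real.exp (-C))
    obtain ⟨G, hG, hGC⟩ := hC L
    refine ⟨G.sup id, ?_⟩
    simp only [wE_mul]
    have hinj : Set.InjOn (fun k : ℕ => k - 1) (G : Set ℕ) := by
      intro a ha b hb hab
      have h1 := (hGC a ha).1
      have h2 := (hGC b hb).1
      simp only at hab
      omega
    have hsub : G.image (fun k => k - 1) ⊆ range (G.sup id) := by
      intro i hi
      obtain ⟨k, hk, rfl⟩ := Finset.mem_image.1 hi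
      have h1 := (hGC k hk).1
      have h2 : k ≤ G.sup id := Finset.le_sup (f := id) hk
      rw [Finset.mem_range]; omega
    refine le_trans ?_ (Finset.sum_le_sum_of_subset_of_nonneg hsub
      (fun i _ _ => (one_div_pos.2 (cE_pos 𝔣 α x i)).le))
    rw [Finset.sum_image hinj]
    have hterm : ∀ k ∈ G, Real.exp (-C) ≤ 1 / cE 𝔣 α x (k - 1) := by
      intro k hk
      obtain ⟨h1, h2⟩ := hGC k hk
      rw [le_div_iff₀ (cE_pos _ _ _ _)]
      unfold cE
      rw [Nat.sub_add_cancel h1]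
      have h3 := (abs_le.1 (h2 x)).2
      have h4 : Real.exp (-C) * Real.exp (∑ j ∈ range k, 𝔣 (pt α x (j : ℤ))) ≤ 1 := by
        rw [← Real.exp_add]
        apply Real.exp_le_one_iff.2; linarith
      have h5 := pOf_pos 𝔣 x
      have h6 := pOf_lt 𝔣 x
      calc _ = (1 - pOf 𝔣 x) *
            (Real.exp (-C) * Real.exp (∑ j ∈ range k, 𝔣 (pt α x (j : ℤ)))) := by ring
        _ ≤ 1 * 1 := by
            apply mul_le_mul (by linarith) h4 (by positivity) (by norm_num)
        _ = 1 := by norm_num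
    have := Finset.card_nsmul_le_sum G _ _ hterm
    rw [hG, nsmul_eq_mul] at this
    rw [div_le_iff₀ (Real.exp_pos _)] at hL
    linarith

lemma balance (w c pr : ℕ → ℝ) (ψ : ℤ → ℝ) (par : ℕ → Prop) (halt : ∀ k, par (k + 1) ↔ ¬ par k)
    (hw0 : w 0 = 1) (h1 : ∀ k, w k * pr k = c k) (h2 : ∀ k, w (k + 1) * (1 - pr (k + 1)) = c k)
    (q : ℕ) :
    ∑ k ∈ range (q + 1), (if par k then w k * (pr k * ψ (k + 1) + (1 - pr k) * ψ (k - 1)) else 0)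
      - ∑ k ∈ range (q + 1), (if par k then 0 else w k * ψ k) =
    (if par 0 then (1 - pr 0) * ψ (-1) else -((1 - pr 0) * ψ 0)) +
      (if par q then c q * ψ (q + 1) else -(c q * ψ q)) := by
  induction q with
  | zero =>
    have e := h1 0
    rw [hw0] at e
    simp only [zero_add, Finset.sum_range_one, hw0]
    by_cases hp : par 0
    · simp only [hp, if_true, ← e]; norm_num; ring
    · simp only [hp, if_false, ← e]; norm_num; ring
  | succ q ih =>
    rw [Finset.sum_range_succ, Finset.sum_range_succ _ (q + 1)]
    have e1 := h1 (q + 1)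
    have e2 := h2 q
    have hq : ((q + 1 : ℕ) : ℤ) - 1 = q := by push_cast; ring
    have hq' : ((q + 1 : ℕ) : ℤ) = (q : ℤ) + 1 := by push_cast; ring
    rw [hq]
    by_cases hp : par q
    · have hp' : ¬ par (q + 1) := by rw [halt]; simpa using hp
      simp only [hp, hp', if_true, if_false] at ih ⊢
      have e3 : w (q + 1) = c (q + 1) + c q := by linarith
      rw [e3, hq']
      linarith
    · have hp' : par (q + 1) := by rw [halt]; exact hp
      simp only [hp, hp', if_true, if_false] at ih ⊢
      have : w (q + 1) * (pr (q + 1) * ψ (((q + 1 : ℕ) : ℤ) + 1) + (1 - pr (q + 1)) * ψ q) =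
        c (q + 1) * ψ (((q + 1 : ℕ) : ℤ) + 1) + c q * ψ q := by
        rw [← e1, ← e2]; ring
      rw [this]
      linarith

def Iw (𝔣 : UnitAddCircle → ℝ) (α : ℝ) (x : UnitAddCircle) (q : ℕ) (par : ℕ → Prop)
    (h : UnitAddCircle → ℝ) : ℝ :=
  ∑ k ∈ (Finset.range q).filter par, muC (pOf 𝔣) α x (k : ℤ) * h (pt α x (k : ℤ))

def Pφ (𝔣 : UnitAddCircle → ℝ) (α : ℝ) (φ : UnitAddCircle → ℝ) : UnitAddCircle → ℝ :=
  fun z => pOf 𝔣 z * φ (z + ((α : ℝ) : UnitAddCircle)) +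
    (1 - pOf 𝔣 z) * φ (z - ((α : ℝ) : UnitAddCircle))

lemma Pφ_pt (𝔣 : UnitAddCircle → ℝ) (α : ℝ) (φ : UnitAddCircle → ℝ) (x : UnitAddCircle) (k : ℤ) :
    Pφ 𝔣 α φ (pt α x k) = pOf 𝔣 (pt α x k) * φ (pt α x (k + 1)) +
      (1 - pOf 𝔣 (pt α x k)) * φ (pt α x (k - 1)) := by
  unfold Pφ
  have e1 : pt α x k + ((α : ℝ) : UnitAddCircle) = pt α x (k + 1) := by
    simp only [pt]
    rw [add_assoc, ← AddCircle.coe_add]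
    congr 2; push_cast; ring
  have e2 : pt α x k - ((α : ℝ) : UnitAddCircle) = pt α x (k - 1) := by
    simp only [pt]
    rw [add_sub_assoc, ← AddCircle.coe_sub]
    congr 2; push_cast; ring
  rw [e1, e2]

lemma Pφ_bound (𝔣 : UnitAddCircle → ℝ) (α : ℝ) (φ : UnitAddCircle → ℝ) (B : ℝ)
    (hB : ∀ z, |φ z| ≤ B) (z : UnitAddCircle) : |Pφ 𝔣 α φ z| ≤ B := by
  unfold Pφ
  have h0 := pOf_pos 𝔣 z
  have h1 := pOf_lt 𝔣 z
  have a := abs_le.1 (hB (z + ((α : ℝ) : UnitAddCircle)))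
  have b := abs_le.1 (hB (z - ((α : ℝ) : UnitAddCircle)))
  rw [abs_le]
  constructor <;> nlinarith

lemma Iw_bal (𝔣 : UnitAddCircle → ℝ) (h𝔣 : ZeroMeanBV 𝔣) (α : ℝ) (hα : Irrational α)
    (x : UnitAddCircle) (q : ℕ) (par par' : ℕ → Prop) (hpp : ∀ k, par' k ↔ ¬ par k)
    (halt : ∀ k, par (k + 1) ↔ ¬ par k) (φ : UnitAddCircle → ℝ) (B : ℝ) (hB : ∀ z, |φ z| ≤ B) :
    |Iw 𝔣 α x (q + 1) par (Pφ 𝔣 α φ) - Iw 𝔣 α x (q + 1) par' φ| ≤ B * (2 + cE 𝔣 α x q) := by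
  have hB0 : 0 ≤ B := (abs_nonneg _).trans (hB x)
  have hb := balance (wE 𝔣 α x) (cE 𝔣 α x) (fun k => pOf 𝔣 (pt α x (k : ℤ)))
    (fun k => φ (pt α x k)) par halt (wE_zero 𝔣 α x) (wE_mul 𝔣 α x) (wE_succ_mul 𝔣 α x) q
  have h0 : ∀ z, 0 ≤ pOf 𝔣 z := fun z => (pOf_pos 𝔣 z).le
  have h1 : ∀ z, pOf 𝔣 z ≤ 1 := fun z => (pOf_lt 𝔣 z).le
  have hm0 := muC_nonneg h0 h1 α x 0
  have hm1 := muC_zero_le h0 h1 α x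
  set m0 := muC (pOf 𝔣) α x 0 with hm0def
  have key : ∀ (Q : ℕ → Prop) (h : UnitAddCircle → ℝ),
      Iw 𝔣 α x (q + 1) Q h = ∑ k ∈ range (q + 1),
        (if Q k then wE 𝔣 α x k * h (pt α x (k : ℤ)) else 0) + (if Q 0 then (m0 - 1) * h x else 0) := by
    intro Q h
    unfold Iw
    rw [Finset.sum_filter, Finset.sum_range_succ', Finset.sum_range_succ', add_assoc]
    congr 1
    · apply Finset.sum_congr rfl
      intro k _
      rw [muC_eq 𝔣 h𝔣 α hα x k]
    · rw [wE_zero]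
      simp only [Nat.cast_zero, pt_zero]
      by_cases hQ : Q 0
      · simp only [hQ, if_true]; rw [← hm0def]; ring
      · simp only [hQ, if_false]; ring
  rw [key, key]
  have e1 : ∑ k ∈ range (q + 1), (if par k then wE 𝔣 α x k * Pφ 𝔣 α φ (pt α x (k : ℤ)) else 0) =
      ∑ k ∈ range (q + 1), (if par k then wE 𝔣 α x k *
        (pOf 𝔣 (pt α x (k : ℤ)) * φ (pt α x (k + 1)) +
          (1 - pOf 𝔣 (pt α x (k : ℤ))) * φ (pt α x (k - 1))) else 0) := by
    simp only [Pφ_pt]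
  have e2 : ∑ k ∈ range (q + 1), (if par' k then wE 𝔣 α x k * φ (pt α x (k : ℤ)) else 0) =
      ∑ k ∈ range (q + 1), (if par k then 0 else wE 𝔣 α x k * φ (pt α x (k : ℤ))) := by
    apply Finset.sum_congr rfl
    intro k _
    by_cases hp : par k
    · have : ¬ par' k := by rw [hpp]; simpa using hp
      simp [hp, this]
    · have : par' k := by rw [hpp]; exact hp
      simp [hp, this]
  rw [e1, e2]
  have hc := cE_pos 𝔣 α x q
  have E1 : |if par 0 then (1 - pOf 𝔣 (pt α x ((0 : ℕ) : ℤ))) * φ (pt α x (-1))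
      else -((1 - pOf 𝔣 (pt α x ((0 : ℕ) : ℤ))) * φ (pt α x 0))| ≤ B := by
    have a0 := h0 (pt α x ((0 : ℕ) : ℤ))
    have a1 := h1 (pt α x ((0 : ℕ) : ℤ))
    have : ∀ z, |(1 - pOf 𝔣 (pt α x ((0 : ℕ) : ℤ))) * φ z| ≤ B := by
      intro z
      rw [abs_mul, abs_of_nonneg (by linarith)]
      have := hB z
      have := abs_nonneg (φ z)
      nlinarith
    split_ifs
    · exact this _
    · rw [abs_neg]; exact this _
  have E2 : |if par q then cE 𝔣 α x q * φ (pt α x (q + 1)) else -(cE 𝔣 α x q * φ (pt α x q))|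
      ≤ B * cE 𝔣 α x q := by
    have : ∀ z, |cE 𝔣 α x q * φ z| ≤ B * cE 𝔣 α x q := by
      intro z
      rw [abs_mul, abs_of_pos hc, mul_comm]
      exact mul_le_mul_of_nonneg_right (hB z) hc.le
    split_ifs
    · exact this _
    · rw [abs_neg]; exact this _
  have E3 : |(if par 0 then (m0 - 1) * Pφ 𝔣 α φ x else 0) - (if par' 0 then (m0 - 1) * φ x else 0)|
      ≤ B := by
    have : ∀ t, |t| ≤ B → |(m0 - 1) * t| ≤ B := by
      intro t ht
      rw [abs_mul, abs_of_nonpos (by linarith)]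
      have := abs_nonneg t
      nlinarith
    by_cases hp : par 0
    · have hp' : ¬ par' 0 := by rw [hpp]; simpa using hp
      simp only [hp, hp', if_true, if_false, sub_zero]
      exact this _ (Pφ_bound 𝔣 α φ B hB x)
    · have hp' : par' 0 := by rw [hpp]; exact hp
      simp only [hp, hp', if_true, if_false, zero_sub, abs_neg]
      exact this _ (hB x)
  have F1 := abs_le.1 E1
  have F2 := abs_le.1 E2
  have F3 := abs_le.1 E3
  rw [abs_le]
  constructor <;> linarith

lemma one_sub_pOf_lower (𝔣 : UnitAddCircle → ℝ) (h𝔣 : ZeroMeanBV 𝔣) :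
    ∃ δ : ℝ, 0 < δ ∧ δ ≤ 1 ∧ ∀ z, δ ≤ 1 - pOf 𝔣 z := by
  obtain ⟨D, hD⟩ := (isCompact_range h𝔣.1).bddAbove
  refine ⟨1 / (1 + Real.exp D), by positivity, ?_, fun z => ?_⟩
  · have := Real.exp_pos D
    rw [div_le_one (by positivity)]; linarith
  · rw [one_sub_pOf]
    have := hD ⟨z, rfl⟩
    gcongr

lemma growth (𝔣 : UnitAddCircle → ℝ) (h𝔣 : ZeroMeanBV 𝔣) (α : ℝ) (hα : Irrational α) (K : ℝ) :
    ∃ N : ℕ, ∀ q ≥ N, ∀ x : UnitAddCircle,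
      K * (2 + cE 𝔣 α x q) ≤ ∑ k ∈ range (q + 1), wE 𝔣 α x k := by
  obtain ⟨C, hC⟩ := good_times 𝔣 h𝔣 α hα
  obtain ⟨δ, hδ, hδ1, hδp⟩ := one_sub_pOf_lower 𝔣 h𝔣
  set η := δ * Real.exp (-C) with hη
  have hηpos : 0 < η := by positivity
  obtain ⟨L, hL⟩ := exists_nat_ge (3 * K / η)
  obtain ⟨G, hG, hGC⟩ := hC L
  refine ⟨G.sup id, fun q hq x => ?_⟩
  have hle : ∀ k ∈ G, k ≤ q := fun k hk => (Finset.le_sup (f := id) hk).trans hq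
  have hcw : ∀ k, cE 𝔣 α x k ≤ wE 𝔣 α x k := by
    intro k
    unfold wE
    rw [le_div_iff₀ (pOf_pos _ _)]
    have := cE_pos 𝔣 α x k
    have := pOf_lt 𝔣 (pt α x (k : ℤ))
    nlinarith
  have gen : ∀ (u : ℕ → ℕ) (b : ℝ), Set.InjOn u (G : Set ℕ) → (∀ k ∈ G, u k < q + 1) →
      (∀ k ∈ G, b ≤ cE 𝔣 α x (u k)) → L * b ≤ ∑ k ∈ range (q + 1), wE 𝔣 α x k := by
    intro u b hinj hu hb
    have hsub : G.image u ⊆ range (q + 1) := by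
      intro i hi
      obtain ⟨k, hk, rfl⟩ := Finset.mem_image.1 hi
      exact Finset.mem_range.2 (hu k hk)
    refine le_trans ?_ (Finset.sum_le_sum_of_subset_of_nonneg hsub
      (fun i _ _ => (wE_pos 𝔣 α x i).le))
    rw [Finset.sum_image hinj]
    have := Finset.card_nsmul_le_sum G (fun k => wE 𝔣 α x (u k)) b
      (fun k hk => (hb k hk).trans (hcw _))
    rwa [hG, nsmul_eq_mul] at this
  have s1 := gen (fun k => k - 1) η (by
      intro a ha b hb hab
      have h1 := (hGC a ha).1
      have h2 := (hGC b hb).1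
      simp only at hab
      omega) (by intro k hk; have := hle k hk; change k - 1 < q + 1; omega) (by
      intro k hk
      obtain ⟨h1, h2⟩ := hGC k hk
      simp only [cE]
      rw [Nat.sub_add_cancel h1]
      have h3 := (abs_le.1 (h2 x)).1
      rw [hη]
      apply mul_le_mul (hδp x) (Real.exp_le_exp.2 h3) (Real.exp_pos _).le
      exact hδ.le.trans (hδp x))
  have s2 := gen (fun k => q - k) (η * cE 𝔣 α x q) (by
      intro a ha b hb hab
      have h1 := hle a ha
      have h2 := hle b hb
      simp only at hab
      omega) (by intro k hk; change q - k < q + 1; omega) (by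
      intro k hk
      obtain ⟨h1, h2⟩ := hGC k hk
      have hkq := hle k hk
      have e1 : q + 1 = (q - k + 1) + k := by omega
      have e2 : cE 𝔣 α x q = cE 𝔣 α x (q - k) *
          Real.exp (∑ j ∈ range k, 𝔣 (pt α (pt α x ((q - k + 1 : ℕ) : ℤ)) (j : ℤ))) := by
        unfold cE
        rw [mul_assoc, ← Real.exp_add]
        congr 2
        conv_lhs => rw [e1]
        rw [Finset.sum_range_add]
        congr 1
        apply Finset.sum_congr rfl
        intro j _
        rw [pt_add]; push_cast; rfl
      have h3 := (abs_le.1 (h2 (pt α x ((q - k + 1 : ℕ) : ℤ)))).2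
      rw [e2, hη]
      have hcp := cE_pos 𝔣 α x (q - k)
      set S := ∑ j ∈ range k, 𝔣 (pt α (pt α x ((q - k + 1 : ℕ) : ℤ)) (j : ℤ))
      have h4 : Real.exp (-C) * Real.exp S ≤ 1 := by
        rw [← Real.exp_add]
        apply Real.exp_le_one_iff.2; linarith
      calc _ = δ * (Real.exp (-C) * Real.exp S) * cE 𝔣 α x (q - k) := by ring
        _ ≤ 1 * 1 * cE 𝔣 α x (q - k) := by gcongr
        _ = _ := by ring)
  have hLK : 3 * K ≤ L * η := by rwa [div_le_iff₀ hηpos] at hL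
  have hc := cE_pos 𝔣 α x q
  nlinarith

lemma Iw_total (𝔣 : UnitAddCircle → ℝ) (h𝔣 : ZeroMeanBV 𝔣) (α : ℝ) (hα : Irrational α)
    (x : UnitAddCircle) (q : ℕ) (par par' : ℕ → Prop) (hpp : ∀ k, par' k ↔ ¬ par k) :
    ∑ k ∈ range (q + 1), wE 𝔣 α x k - 1 ≤
      Iw 𝔣 α x (q + 1) par (fun _ => 1) + Iw 𝔣 α x (q + 1) par' (fun _ => 1) := by
  unfold Iw
  rw [Finset.sum_filter, Finset.sum_filter, ← Finset.sum_add_distrib]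
  have e : ∀ k ∈ range (q + 1), ((if par k then muC (pOf 𝔣) α x (k : ℤ) * 1 else 0) +
      (if par' k then muC (pOf 𝔣) α x (k : ℤ) * 1 else 0)) = muC (pOf 𝔣) α x (k : ℤ) := by
    intro k _
    by_cases hp : par k
    · have : ¬ par' k := by rw [hpp]; simpa using hp
      simp [hp, this]
    · have : par' k := by rw [hpp]; exact hp
      simp [hp, this]
  rw [Finset.sum_congr rfl e, Finset.sum_range_succ', Finset.sum_range_succ', wE_zero]
  have hm0 := muC_nonneg (fun z => (pOf_pos 𝔣 z).le) (fun z => (pOf_lt 𝔣 z).le) α x ((0 : ℕ) : ℤ)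
  simp only [muC_eq 𝔣 h𝔣 α hα x]
  linarith

lemma Iw_abs (𝔣 : UnitAddCircle → ℝ) (α : ℝ) (x : UnitAddCircle) (q : ℕ) (par : ℕ → Prop)
    (h : UnitAddCircle → ℝ) (B : ℝ) (hB : ∀ z, |h z| ≤ B) :
    |Iw 𝔣 α x q par h| ≤ B * Iw 𝔣 α x q par (fun _ => 1) := by
  unfold Iw
  refine (Finset.abs_sum_le_sum_abs _ _).trans ?_
  rw [Finset.mul_sum]
  apply Finset.sum_le_sum
  intro k _
  have hm0 := muC_nonneg (fun z => (pOf_pos 𝔣 z).le) (fun z => (pOf_lt 𝔣 z).le) α x (k : ℤ)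
  rw [abs_mul, abs_of_nonneg hm0, mul_one, mul_comm]
  exact mul_le_mul_of_nonneg_right (hB _) hm0

lemma integral_nuMeas (𝔣 : UnitAddCircle → ℝ) (α : ℝ) (x : UnitAddCircle) (q : ℕ)
    (par : ℕ → Prop) (h : UnitAddCircle → ℝ) :
    ∫ z, h z ∂(nuMeas (pOf 𝔣) α x q par) =
      Iw 𝔣 α x q par h / Iw 𝔣 α x q par (fun _ => 1) := by
  have hm0 : ∀ k : ℕ, 0 ≤ muC (pOf 𝔣) α x (k : ℤ) := fun k =>
    muC_nonneg (fun z => (pOf_pos 𝔣 z).le) (fun z => (pOf_lt 𝔣 z).le) α x (k : ℤ)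
  unfold nuMeas
  rw [integral_smul_measure, integral_finsetSum_measure]
  · have e1 : ((∑ k ∈ (Finset.range q).filter par,
        ENNReal.ofReal (muC (pOf 𝔣) α x (k : ℤ)))⁻¹).toReal =
        (Iw 𝔣 α x q par (fun _ => 1))⁻¹ := by
      rw [ENNReal.toReal_inv, ← ENNReal.ofReal_sum_of_nonneg (fun k _ => hm0 k),
        ENNReal.toReal_ofReal (Finset.sum_nonneg (fun k _ => hm0 k))]
      simp [Iw]
    rw [e1, smul_eq_mul, div_eq_inv_mul]
    congr 1
    unfold Iw
    apply Finset.sum_congr rfl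
    intro k _
    rw [integral_smul_measure, integral_dirac, ENNReal.toReal_ofReal (hm0 k), smul_eq_mul]
  · intro k _
    apply Integrable.smul_measure _ ENNReal.ofReal_ne_top
    exact integrable_dirac (by simp)

lemma limit_lemma (𝔣 : UnitAddCircle → ℝ) (h𝔣 : ZeroMeanBV 𝔣) (α : ℝ) (hα : Irrational α)
    (x : ℕ → UnitAddCircle) (q : ℕ → ℕ) (hmono : StrictMono q)
    (par par' : ℕ → Prop) (hpp : ∀ k, par' k ↔ ¬ par k)
    (halt : ∀ k, par (k + 1) ↔ ¬ par k) (φ : UnitAddCircle → ℝ) (B : ℝ) (hB : ∀ z, |φ z| ≤ B) :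
    Tendsto (fun n => ∫ z, Pφ 𝔣 α φ z ∂(nuMeas (pOf 𝔣) α (x n) (q n) par) -
      ∫ z, φ z ∂(nuMeas (pOf 𝔣) α (x n) (q n) par')) atTop (nhds 0) := by
  have hB0 : 0 ≤ B := (abs_nonneg _).trans (hB 0)
  rw [Metric.tendsto_atTop]
  intro ε hε
  set K : ℝ := 2 * B / ε + 1 with hK
  have hKpos : 0 < K := by positivity
  obtain ⟨N, hN⟩ := growth 𝔣 h𝔣 α hα (2 * K + 2)
  refine ⟨N + 1, fun n hn => ?_⟩
  have hqn : N + 1 ≤ q n := hn.trans (hmono.id_le n)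
  obtain ⟨Q, hQ⟩ : ∃ Q, q n = Q + 1 := ⟨q n - 1, by omega⟩
  rw [Real.dist_eq, sub_zero, integral_nuMeas, integral_nuMeas, hQ]
  have g1 := hN Q (by omega) (x n)
  have g2 := Iw_total 𝔣 h𝔣 α hα (x n) Q par par' hpp
  have g3 := Iw_bal 𝔣 h𝔣 α hα (x n) Q par par' hpp halt (fun _ => 1) 1 (by simp)
  have g4 := Iw_bal 𝔣 h𝔣 α hα (x n) Q par par' hpp halt φ B hB
  have g5 := Iw_abs 𝔣 α (x n) (Q + 1) par' φ B hB
  have hc := cE_pos 𝔣 α (x n) Q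
  have e1 : Pφ 𝔣 α (fun _ => (1 : ℝ)) = fun _ => 1 := by
    funext z; unfold Pφ; ring
  rw [e1, one_mul] at g3
  set r := 2 + cE 𝔣 α (x n) Q with hr
  set O := Iw 𝔣 α (x n) (Q + 1) par (fun _ => 1)
  set E := Iw 𝔣 α (x n) (Q + 1) par' (fun _ => 1)
  set a := Iw 𝔣 α (x n) (Q + 1) par (Pφ 𝔣 α φ)
  set b := Iw 𝔣 α (x n) (Q + 1) par' φ
  have g3' := abs_le.1 g3
  have hr1 : 2 < r := by linarith
  have hO : K * r < O := by nlinarith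
  have hE : K * r < E := by nlinarith
  have hKr : 0 < K * r := by positivity
  have hOp : 0 < O := by linarith
  have hEp : 0 < E := by linarith
  have e2 : a / O - b / E = (a - b) / O + b * (E - O) / (O * E) := by
    field_simp; ring
  rw [e2]
  have t1 : |(a - b) / O| ≤ B * r / O := by
    rw [abs_div, abs_of_pos hOp]; gcongr
  have t2 : |b * (E - O) / (O * E)| ≤ B * r / O := by
    rw [abs_div, abs_of_pos (mul_pos hOp hEp), abs_mul, abs_sub_comm E O]
    rw [div_le_div_iff₀ (mul_pos hOp hEp) hOp]
    calc |b| * |O - E| * O ≤ (B * E) * r * O := by gcongr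
      _ = _ := by ring
  have t3 : B * r / O + B * r / O < ε := by
    rw [← add_div, div_lt_iff₀ hOp]
    have : ε * K = 2 * B + ε := by rw [hK]; field_simp
    have : ε * (K * r) < ε * O := by gcongr
    nlinarith
  exact (abs_add_le _ _).trans_lt (by linarith)

lemma pOf_cont (𝔣 : UnitAddCircle → ℝ) (hc : Continuous 𝔣) : Continuous (pOf 𝔣) := by
  unfold pOf
  have : ∀ z, 1 + Real.exp (𝔣 z) ≠ 0 := fun z => by positivity
  fun_prop (disch := exact this)

lemma integral_Pop (𝔣 : UnitAddCircle → ℝ) (hc : Continuous 𝔣) (α : ℝ)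
    (ν : Measure UnitAddCircle) [IsFiniteMeasure ν] (φ : UnitAddCircle → ℝ) (hφ : Continuous φ) :
    IsFiniteMeasure (Pop (pOf 𝔣) α ν) ∧
      ∫ z, φ z ∂(Pop (pOf 𝔣) α ν) = ∫ z, Pφ 𝔣 α φ z ∂ν := by
  have hp := pOf_cont 𝔣 hc
  have hcompact : ∀ g : UnitAddCircle → ℝ, Continuous g → ∀ (m : Measure UnitAddCircle)
      [IsFiniteMeasure m], Integrable g m := fun g hg m _ =>
    hg.integrable_of_hasCompactSupport (HasCompactSupport.of_compactSpace g)
  have f1 : IsFiniteMeasure (ν.withDensity fun z => ENNReal.ofReal (pOf 𝔣 z)) :=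
    isFiniteMeasure_withDensity_ofReal (hcompact _ hp ν).2
  have f2 : IsFiniteMeasure (ν.withDensity fun z => ENNReal.ofReal (1 - pOf 𝔣 z)) :=
    isFiniteMeasure_withDensity_ofReal
      (hcompact (fun z => 1 - pOf 𝔣 z) (continuous_const.sub hp) ν).2
  have m1 : Continuous (fun z : UnitAddCircle => z + ((α : ℝ) : UnitAddCircle)) := by fun_prop
  have m2 : Continuous (fun z : UnitAddCircle => z - ((α : ℝ) : UnitAddCircle)) := by fun_prop
  have hq : Measurable (fun z => ENNReal.ofReal (1 - pOf 𝔣 z)) :=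
    (show Continuous (fun z => 1 - pOf 𝔣 z) from continuous_const.sub hp).measurable.ennreal_ofReal
  unfold Pop
  refine ⟨inferInstance, ?_⟩
  rw [integral_add_measure (hcompact φ hφ _) (hcompact φ hφ _),
    integral_map m1.aemeasurable hφ.aestronglyMeasurable,
    integral_map m2.aemeasurable hφ.aestronglyMeasurable,
    integral_withDensity_eq_integral_toReal_smul (hp.measurable.ennreal_ofReal) (by simp),
    integral_withDensity_eq_integral_toReal_smul hq (by simp)]
  have e1 : ∀ z, (ENNReal.ofReal (pOf 𝔣 z)).toReal = pOf 𝔣 z := fun z =>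
    ENNReal.toReal_ofReal (pOf_pos 𝔣 z).le
  have e2 : ∀ z, (ENNReal.ofReal (1 - pOf 𝔣 z)).toReal = 1 - pOf 𝔣 z := fun z =>
    ENNReal.toReal_ofReal (sub_pos.2 (pOf_lt 𝔣 z)).le
  simp only [e1, e2, smul_eq_mul]
  rw [← integral_add]
  · rfl
  · exact hcompact _ (by fun_prop) ν
  · exact hcompact _ (by fun_prop) ν

lemma Pop_eq (𝔣 : UnitAddCircle → ℝ) (h𝔣 : ZeroMeanBV 𝔣) (α : ℝ) (hα : Irrational α)
    (x : ℕ → UnitAddCircle) (q : ℕ → ℕ) (hmono : StrictMono q)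
    (par par' : ℕ → Prop) (hpp : ∀ k, par' k ↔ ¬ par k)
    (halt : ∀ k, par (k + 1) ↔ ¬ par k) (ν₁ ν₂ : Measure UnitAddCircle)
    [IsProbabilityMeasure ν₁] [IsProbabilityMeasure ν₂]
    (hconv₁ : ∀ φ : C(UnitAddCircle, ℝ),
      Tendsto (fun n => ∫ z, φ z ∂(nuMeas (pOf 𝔣) α (x n) (q n) par))
        atTop (nhds (∫ z, φ z ∂ν₁)))
    (hconv₂ : ∀ φ : C(UnitAddCircle, ℝ),
      Tendsto (fun n => ∫ z, φ z ∂(nuMeas (pOf 𝔣) α (x n) (q n) par'))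
        atTop (nhds (∫ z, φ z ∂ν₂))) :
    Pop (pOf 𝔣) α ν₁ = ν₂ := by
  have := (integral_Pop 𝔣 h𝔣.1 α ν₁ (fun _ => 0) continuous_const).1
  apply ext_of_forall_integral_eq_of_IsFiniteMeasure
  intro φ
  rw [(integral_Pop 𝔣 h𝔣.1 α ν₁ φ φ.continuous).2]
  have hp := pOf_cont 𝔣 h𝔣.1
  have hPc : Continuous (Pφ 𝔣 α φ) := by
    unfold Pφ
    have := φ.continuous
    fun_prop
  have t1 := hconv₁ ⟨Pφ 𝔣 α φ, hPc⟩
  have t2 := hconv₂ ⟨φ, φ.continuous⟩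
  have t3 := limit_lemma 𝔣 h𝔣 α hα x q hmono par par' hpp halt φ ‖φ‖ (fun z => φ.norm_coe_le_norm z)
  have t4 := t1.sub t2
  have := tendsto_nhds_unique t4 t3
  exact sub_eq_zero.1 this

/-- Lemma 3.1: let `𝔣` be continuous of bounded variation with
`∫_𝕋 𝔣 = 0`, `𝔭 = e^𝔣/(1+e^𝔣)`, `P` the Markov operator of the kernel
`p(x,·) = 𝔭(x)δ_{x+α} + 𝔮(x)δ_{x-α}`, and `μ⋆` its unique stationary measure. If
`(x_n) ⊆ 𝕋` and `q_1 < q_2 < ⋯` are close return times of `α` such that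
`ν_{x_n,q_n}^{odd} → ν₁` and `ν_{x_n,q_n}^{even} → ν₂` in the weak-* topology, then
`Pν₁ = ν₂`, `Pν₂ = ν₁`, and `(1/2)ν₁ + (1/2)ν₂ = μ⋆`. -/
theorem statement11 (α : ℝ) (hα : Irrational α) (𝔣 : UnitAddCircle → ℝ)
    (h𝔣 : ZeroMeanBV 𝔣) (μstar : Measure UnitAddCircle)
    (hμ : IsUniqueStationary (pOf 𝔣) α μstar)
    (x : ℕ → UnitAddCircle) (q : ℕ → ℕ) (hmono : StrictMono q)
    (hclose : ∀ n, CloseReturnTime α (q n))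
    (ν₁ ν₂ : Measure UnitAddCircle)
    (hν₁ : IsProbabilityMeasure ν₁) (hν₂ : IsProbabilityMeasure ν₂)
    (hconv₁ : ∀ φ : C(UnitAddCircle, ℝ),
      Tendsto (fun n => ∫ z, φ z ∂(nuMeas (pOf 𝔣) α (x n) (q n) (fun k => Odd k)))
        atTop (nhds (∫ z, φ z ∂ν₁)))
    (hconv₂ : ∀ φ : C(UnitAddCircle, ℝ),
      Tendsto (fun n => ∫ z, φ z ∂(nuMeas (pOf 𝔣) α (x n) (q n) (fun k => Even k)))
        atTop (nhds (∫ z, φ z ∂ν₂))) :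
    Pop (pOf 𝔣) α ν₁ = ν₂ ∧ Pop (pOf 𝔣) α ν₂ = ν₁ ∧
      (2 : ENNReal)⁻¹ • ν₁ + (2 : ENNReal)⁻¹ • ν₂ = μstar := by
  have h1 : Pop (pOf 𝔣) α ν₁ = ν₂ :=
    Pop_eq 𝔣 h𝔣 α hα x q hmono (fun k => Odd k) (fun k => Even k)
      (fun k => Nat.not_odd_iff_even.symm) (fun k => Nat.odd_add_one) ν₁ ν₂ hconv₁ hconv₂
  have h2 : Pop (pOf 𝔣) α ν₂ = ν₁ :=
    Pop_eq 𝔣 h𝔣 α hα x q hmono (fun k => Even k) (fun k => Odd k)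
      (fun k => Nat.not_even_iff_odd.symm) (fun k => Nat.even_add_one) ν₂ ν₁ hconv₂ hconv₁
  refine ⟨h1, h2, hμ.2.2 _ ⟨?_⟩ ?_⟩
  · simp only [Measure.add_apply, Measure.smul_apply, measure_univ, smul_eq_mul, mul_one]
    exact ENNReal.inv_two_add_inv_two
  · have m1 : Measurable (fun z : UnitAddCircle => z + ((α : ℝ) : UnitAddCircle)) := by fun_prop
    have m2 : Measurable (fun z : UnitAddCircle => z - ((α : ℝ) : UnitAddCircle)) := by fun_prop
    have hadd : ∀ a b : Measure UnitAddCircle,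
        Pop (pOf 𝔣) α (a + b) = Pop (pOf 𝔣) α a + Pop (pOf 𝔣) α b := by
      intro a b
      unfold Pop
      rw [withDensity_add_measure, withDensity_add_measure, Measure.map_add _ _ m1,
        Measure.map_add _ _ m2]
      abel
    have hsmul : ∀ (c : ENNReal) (a : Measure UnitAddCircle),
        Pop (pOf 𝔣) α (c • a) = c • Pop (pOf 𝔣) α a := by
      intro c a
      unfold Pop
      rw [withDensity_smul_measure, withDensity_smul_measure, Measure.map_smul, Measure.map_smul,
        smul_add]
    rw [hadd, hsmul, hsmul, h1, h2, add_comm]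
end
end

section
/- Every trigonometric polynomial 𝔣 with ∫_𝕋 𝔣(x) dx = 0 belongs to A_m for every positive integer m; that is, for every zero-mean trigonometric polynomial 𝔣 and every m there exists n ≥ 1 such that ℙ_x(max_{j≤n} ξ_j = ξ_n) < 1/m for all x ∈ 𝕋, where (ξ_n) is the random walk in the environment (𝔭, α, x) with 𝔭 = e^𝔣/(1+e^𝔣). -/
open MeasureTheory Filter Finset

noncomputable section

attribute [local instance] Classical.propDecidable

/-- One-step transition probability of the random walk on `ℤ` in the quasi-periodic
environment `(𝔭, α, x)`: from `j` it jumps to `j+1` with probability `𝔭(x+jα)` and to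
`j-1` with probability `𝔮(x+jα) = 1-𝔭(x+jα)`. -/
def stepProb (𝔭 : UnitAddCircle → ℝ) (α : ℝ) (x : UnitAddCircle) (j j' : ℤ) : ℝ :=
  if j' = j + 1 then 𝔭 (pt α x j) else if j' = j - 1 then 1 - 𝔭 (pt α x j) else 0

/-- `ξ` is (a version of) the random walk on `ℤ` in the quasi-periodic environment
`(𝔭, α, x)` started at `start`, defined on the probability space `(Ω, ℙ)`; this is
expressed through its finite-dimensional distributions. -/
def IsQPWalk (𝔭 : UnitAddCircle → ℝ) (α : ℝ) (x : UnitAddCircle) (start : ℤ)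
    {Ω : Type} [MeasurableSpace Ω] (ℙ : Measure Ω) (ξ : ℕ → Ω → ℤ) : Prop :=
  IsProbabilityMeasure ℙ ∧ (∀ n, Measurable (ξ n)) ∧
  ∀ (n : ℕ) (k : ℕ → ℤ),
    ℙ {ω | ∀ i ≤ n, ξ i ω = k i} =
      ENNReal.ofReal ((if k 0 = start then (1 : ℝ) else 0) *
        ∏ i ∈ Finset.range n, stepProb 𝔭 α x (k i) (k (i + 1)))

/-- `f : ℝ → ℝ` is absolutely continuous on `[0,1]`. -/
def AbsolutelyContinuousOn01 (f : ℝ → ℝ) : Prop :=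
  ∀ ε > 0, ∃ δ > 0, ∀ (n : ℕ) (a b : Fin n → ℝ),
    (∀ i, a i ∈ Set.Icc (0:ℝ) 1 ∧ b i ∈ Set.Icc (0:ℝ) 1 ∧ a i ≤ b i) →
    (Pairwise fun i j => Disjoint (Set.Ioo (a i) (b i)) (Set.Ioo (a j) (b j))) →
    ∑ i, (b i - a i) < δ → ∑ i, |f (b i) - f (a i)| < ε

/-- Membership in the space `𝒫` of absolutely continuous functions on the circle with
`∫_𝕋 𝔣(z) dz = 0`. -/
def memP (𝔣 : UnitAddCircle → ℝ) : Prop :=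
  Continuous 𝔣 ∧ AbsolutelyContinuousOn01 (fun t : ℝ => 𝔣 (t : UnitAddCircle)) ∧
    ∫ z : UnitAddCircle, 𝔣 z = 0

/-- The norm `‖f‖_BV = ‖f‖_∞ + var(f)` on functions on the circle. -/
def bvNorm (f : UnitAddCircle → ℝ) : ℝ :=
  (⨆ x : UnitAddCircle, |f x|) +
    (eVariationOn (fun t : ℝ => f (t : UnitAddCircle)) (Set.Icc 0 1)).toReal

/-- The set `A_m = {𝔣 ∈ 𝒫 : ∃ n ≥ 1, ∀ x ∈ 𝕋, ℙ_x(max_{j≤n} ξ_j = ξ_n) < 1/m}`. -/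
def Am (α : ℝ) (m : ℕ) : Set (UnitAddCircle → ℝ) :=
  {𝔣 | memP 𝔣 ∧ ∃ n : ℕ, 1 ≤ n ∧
    ∀ (x : UnitAddCircle) (Ω : Type) [MeasurableSpace Ω] (ℙ : Measure Ω)
      (ξ : ℕ → Ω → ℤ), IsQPWalk (pOf 𝔣) α x 0 ℙ ξ →
      (ℙ {ω | ∀ j ≤ n, ξ j ω ≤ ξ n ω}).toReal < 1 / (m : ℝ)}

/-- `𝔣` is a zero-mean trigonometric polynomial on the circle (no constant term). -/
def IsZeroMeanTrigPoly (𝔣 : UnitAddCircle → ℝ) : Prop :=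
  ∃ (N : ℕ) (c d : ℕ → ℝ), ∀ t : ℝ,
    𝔣 (t : UnitAddCircle) = ∑ k ∈ Finset.range N,
      (c k * Real.cos (2 * Real.pi * ((k : ℝ) + 1) * t) +
        d k * Real.sin (2 * Real.pi * ((k : ℝ) + 1) * t))

/-- operator on functions on `ℤ` with sup-norm bound `C` -/
def BdOp (C : ℝ) (A : Module.End ℝ (ℤ → ℝ)) : Prop :=
  ∀ (φ : ℤ → ℝ) (M : ℝ), (∀ x, |φ x| ≤ M) → ∀ x, |A φ x| ≤ C * M

lemma BdOp.one : BdOp 1 1 := by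
  intro φ M h x
  simpa using h x

lemma BdOp.mul {C D : ℝ} {A B : Module.End ℝ (ℤ → ℝ)} (hA : BdOp C A) (hB : BdOp D B) :
    BdOp (C * D) (A * B) := by
  intro φ M h x
  have := hA (B φ) (D * M) (hB φ M h) x
  rw [mul_assoc]
  exact this

lemma BdOp.add {C D : ℝ} {A B : Module.End ℝ (ℤ → ℝ)} (hA : BdOp C A) (hB : BdOp D B) :
    BdOp (C + D) (A + B) := by
  intro φ M h x
  have h1 := hA φ M h x
  have h2 := hB φ M h x
  have h3 := abs_add_le (A φ x) (B φ x)
  have h4 : (A + B) φ x = A φ x + B φ x := rfl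
  rw [h4]; linarith

lemma BdOp.smul {C a : ℝ} (ha : 0 ≤ a) {A : Module.End ℝ (ℤ → ℝ)} (hA : BdOp C A) :
    BdOp (a * C) (a • A) := by
  intro φ M h x
  have h1 := hA φ M h x
  have h4 : (a • A) φ x = a * A φ x := rfl
  rw [h4, abs_mul, abs_of_nonneg ha, mul_assoc]
  exact mul_le_mul_of_nonneg_left h1 ha

lemma BdOp.neg {C : ℝ} {A : Module.End ℝ (ℤ → ℝ)} (hA : BdOp C A) :
    BdOp C (-A) := by
  intro φ M h x
  have h1 := hA φ M h x
  have h4 : (-A) φ x = - A φ x := rfl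
  rw [h4, abs_neg]
  exact h1

lemma BdOp.mono {C D : ℝ} {A : Module.End ℝ (ℤ → ℝ)} (hA : BdOp C A) (h : C ≤ D) :
    BdOp D A := by
  intro φ M hM x
  have h1 := hA φ M hM x
  have : 0 ≤ M := le_trans (abs_nonneg _) (hM 0)
  nlinarith

lemma BdOp.pow {A : Module.End ℝ (ℤ → ℝ)} (hA : BdOp 1 A) (n : ℕ) : BdOp 1 (A ^ n) := by
  induction n with
  | zero => simpa using BdOp.one
  | succ n ih => rw [pow_succ]; simpa using ih.mul hA

lemma BdOp.sum {ι : Type} (s : Finset ι) (C : ι → ℝ) (A : ι → Module.End ℝ (ℤ → ℝ))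
    (h : ∀ i ∈ s, BdOp (C i) (A i)) : BdOp (∑ i ∈ s, C i) (∑ i ∈ s, A i) := by
  induction s using Finset.induction_on with
  | empty => intro φ M hM x; simp
  | insert a s ha ih =>
    rw [Finset.sum_insert ha, Finset.sum_insert ha]
    exact (h a (Finset.mem_insert_self _ _)).add
      (ih fun i hi => h i (Finset.mem_insert_of_mem hi))

lemma bdop_key (c : ℝ) (hc0 : 0 < c) (hc1 : c < 1) (ε : ℝ) (hε : 0 < ε) :
    ∃ J : ℕ, ∀ R : Module.End ℝ (ℤ → ℝ), BdOp 1 R →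
      BdOp ε ((c • (1 : Module.End ℝ (ℤ → ℝ)) + (1 - c) • R) ^ J * (1 - R)) := by
  obtain ⟨k, hk⟩ := exists_nat_gt (4 / ε)
  set w : ℕ → ℝ := fun i => (1 - c) ^ i * c ^ (k - i) * (k.choose i : ℝ) with hw
  set a := min c (1 - c) with ha
  have ha0 : 0 < a := lt_min hc0 (by linarith)
  set η := a ^ k with hη
  have hη0 : 0 < η := pow_pos ha0 k
  have hwη : ∀ i ∈ Finset.range (k + 1), η ≤ w i := by
    intro i hi
    have hi' : i ≤ k := by simpa [Nat.lt_succ_iff] using hi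
    have h1 : η = a ^ i * a ^ (k - i) := by rw [hη, ← pow_add]; congr 1; omega
    have h2 : (1 : ℝ) ≤ (k.choose i : ℝ) := by exact_mod_cast Nat.choose_pos hi'
    have h3 : a ^ i ≤ (1 - c) ^ i := pow_le_pow_left₀ ha0.le (min_le_right _ _) i
    have h4 : a ^ (k - i) ≤ c ^ (k - i) := pow_le_pow_left₀ ha0.le (min_le_left _ _) _
    have h5 : a ^ i * a ^ (k - i) ≤ (1 - c) ^ i * c ^ (k - i) :=
      mul_le_mul h3 h4 (by positivity) (le_trans (by positivity) h3)
    have h6 : 0 ≤ (1 - c) ^ i * c ^ (k - i) := le_trans (by positivity) h5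
    rw [h1, hw]
    simp only
    nlinarith
  have hwsum : ∑ i ∈ Finset.range (k + 1), w i = 1 := by
    rw [← add_pow]; simp
  set ρ := ∑ i ∈ Finset.range (k + 1), (w i - η) with hρ
  have hρ0 : 0 ≤ ρ := Finset.sum_nonneg fun i hi => by linarith [hwη i hi]
  have hρ1 : ρ = 1 - (k + 1) * η := by
    rw [hρ, Finset.sum_sub_distrib, hwsum]; simp
  have hρlt : ρ < 1 := by rw [hρ1]; nlinarith [(Nat.cast_nonneg k : (0:ℝ) ≤ k)]
  obtain ⟨j, hj⟩ := exists_pow_lt_of_lt_one (show 0 < ε / 4 by positivity) hρlt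
  refine ⟨k * j, fun R hR => ?_⟩
  set T := c • (1 : Module.End ℝ (ℤ → ℝ)) + (1 - c) • R with hT
  have hD : BdOp 2 (1 - R) := by
    rw [sub_eq_add_neg]; exact (BdOp.one.add hR.neg).mono (by norm_num)
  have hTbd : BdOp 1 T :=
    ((BdOp.one.smul hc0.le).add (hR.smul (by linarith : 0 ≤ 1 - c))).mono (by linarith)
  have hcom : Commute T R := by
    rw [hT]
    exact ((Commute.one_left R).smul_left c).add_left ((Commute.refl R).smul_left _)
  set A := ∑ i ∈ Finset.range (k + 1), R ^ i with hA
  set U := ∑ i ∈ Finset.range (k + 1), (w i - η) • R ^ i with hU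
  have hUbd : BdOp ρ U := by
    apply BdOp.sum
    intro i hi
    exact ((hR.pow i).smul (by linarith [hwη i hi])).mono (by linarith)
  have hAD : A * (1 - R) = 1 - R ^ (k + 1) := by
    rw [hA]; exact geom_sum_mul_neg R (k + 1)
  have hADbd : BdOp 2 (A * (1 - R)) := by
    rw [hAD, sub_eq_add_neg]; exact (BdOp.one.add (hR.pow _).neg).mono (by norm_num)
  have hTk : T ^ k = η • A + U := by
    have hc' : Commute ((1 - c) • R) (c • (1 : Module.End ℝ (ℤ → ℝ))) :=
      ((Commute.one_right R).smul_right c).smul_left _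
    rw [hT, add_comm, hc'.add_pow, hA, hU, Finset.smul_sum, ← Finset.sum_add_distrib]
    apply Finset.sum_congr rfl
    intro i _
    have e0 : η • R ^ i + (w i - η) • R ^ i = w i • R ^ i := by module
    rw [e0, hw, smul_pow, smul_pow, one_pow]
    simp only [smul_mul_assoc, mul_smul_comm, mul_one, smul_smul]
    rw [← nsmul_eq_mul', ← Nat.cast_smul_eq_nsmul ℝ, smul_smul]
    congr 1
    ring
  have hUcom : Commute U T := by
    rw [hU]
    apply Commute.sum_left
    intro i _
    exact ((hcom.symm.pow_left i).smul_left _)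
  have main : ∀ j : ℕ, BdOp (2 / (k + 1) + 2 * ρ ^ j) (T ^ (k * j) * (1 - R)) := by
    intro j
    induction j with
    | zero =>
      simp only [mul_zero, pow_zero, one_mul]
      exact hD.mono (by have : (0:ℝ) ≤ 2 / (k + 1) := by positivity
                        linarith)
    | succ j ih =>
      have e : T ^ (k * (j + 1)) * (1 - R)
          = η • (T ^ (k * j) * (A * (1 - R))) + U * (T ^ (k * j) * (1 - R)) := by
        rw [mul_add, mul_one, pow_add, hTk, mul_add, add_mul, ← mul_assoc U,
          (hUcom.pow_right (k * j)).eq, mul_smul_comm, smul_mul_assoc, mul_assoc]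
      rw [e]
      refine ((((hTbd.pow _).mul hADbd).smul hη0.le).add (hUbd.mul ih)).mono ?_
      have : ((k : ℝ) + 1) ≠ 0 := by positivity
      have e2 : ρ * (2 / (k + 1)) = 2 / (k + 1) - 2 * η := by
        rw [hρ1]; field_simp
      rw [mul_add, e2, pow_succ]
      linarith
  refine (main j).mono ?_
  have : (2:ℝ) / (k + 1) ≤ ε / 2 := by
    rw [div_le_iff₀ (by positivity)]
    rw [div_lt_iff₀ hε] at hk
    linarith
  linarith

/-- transition operator -/
def QQ (p : ℤ → ℝ) : Module.End ℝ (ℤ → ℝ) where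
  toFun φ := fun k => p k * φ (k + 1) + (1 - p k) * φ (k - 1)
  map_add' φ ψ := by ext k; simp; ring
  map_smul' a φ := by ext k; simp; ring

lemma QQ_apply (p : ℤ → ℝ) (φ : ℤ → ℝ) (k : ℤ) :
    QQ p φ k = p k * φ (k + 1) + (1 - p k) * φ (k - 1) := rfl

/-- probability of being at the running maximum after `n` steps, started at `k` when the
current maximum is `k + d` -/
def GG (p : ℤ → ℝ) : ℕ → ℤ → ℕ → ℝ
  | 0 => fun _ d => if d = 0 then 1 else 0
  | n + 1 => fun k d => p k * GG p n (k + 1) (d - 1) + (1 - p k) * GG p n (k - 1) (d + 1)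

lemma GG_nonneg (p : ℤ → ℝ) (h0 : ∀ k, 0 ≤ p k) (h1 : ∀ k, p k ≤ 1) (n : ℕ) :
    ∀ k d, 0 ≤ GG p n k d := by
  induction n with
  | zero => intro k d; simp only [GG]; split_ifs <;> norm_num
  | succ n ih =>
    intro k d
    simp only [GG]
    have := h0 k; have := h1 k; have := ih (k + 1) (d - 1); have := ih (k - 1) (d + 1)
    have : 0 ≤ 1 - p k := by linarith
    positivity

lemma GG_anti (p : ℤ → ℝ) (h0 : ∀ k, 0 ≤ p k) (h1 : ∀ k, p k ≤ 1) (n : ℕ) :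
    ∀ k d e, d ≤ e → GG p n k e ≤ GG p n k d := by
  induction n with
  | zero =>
    intro k d e h
    simp only [GG]
    split_ifs <;> first | omega | norm_num
  | succ n ih =>
    intro k d e h
    simp only [GG]
    have a1 := ih (k + 1) (d - 1) (e - 1) (by omega)
    have a2 := ih (k - 1) (d + 1) (e + 1) (by omega)
    have a3 : 0 ≤ 1 - p k := by linarith [h1 k]
    exact add_le_add (mul_le_mul_of_nonneg_left a1 (h0 k)) (mul_le_mul_of_nonneg_left a2 a3)

lemma GG_le_one (p : ℤ → ℝ) (h0 : ∀ k, 0 ≤ p k) (h1 : ∀ k, p k ≤ 1) (n : ℕ) :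
    ∀ k d, GG p n k d ≤ 1 := by
  induction n with
  | zero => intro k d; simp only [GG]; split_ifs <;> norm_num
  | succ n ih =>
    intro k d
    simp only [GG]
    have a1 := ih (k + 1) (d - 1)
    have a2 := ih (k - 1) (d + 1)
    have a3 : 0 ≤ 1 - p k := by linarith [h1 k]
    nlinarith [h0 k]

lemma GG_markov (p : ℤ → ℝ) (h0 : ∀ k, 0 ≤ p k) (h1 : ∀ k, p k ≤ 1) (K j : ℕ) :
    ∀ k d, GG p (j + K) k d ≤ (QQ p ^ j) (fun k => GG p K k 0) k := by
  induction j with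
  | zero => intro k d; simpa using GG_anti p h0 h1 K k 0 d (Nat.zero_le _)
  | succ j ih =>
    intro k d
    rw [show j + 1 + K = (j + K) + 1 by ring, pow_succ']
    change _ ≤ QQ p ((QQ p ^ j) (fun k => GG p K k 0)) k
    rw [QQ_apply]
    simp only [GG]
    have a3 : 0 ≤ 1 - p k := by linarith [h1 k]
    exact add_le_add (mul_le_mul_of_nonneg_left (ih _ _) (h0 k))
      (mul_le_mul_of_nonneg_left (ih _ _) a3)

lemma QQ_bd (p : ℤ → ℝ) (h0 : ∀ k, 0 ≤ p k) (h1 : ∀ k, p k ≤ 1) : BdOp 1 (QQ p) := by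
  intro φ M h x
  rw [QQ_apply]
  have a3 : 0 ≤ 1 - p x := by linarith [h1 x]
  have b1 := abs_le.1 (h (x + 1))
  have b2 := abs_le.1 (h (x - 1))
  rw [abs_le]
  constructor <;> nlinarith [h0 x]

/-- harmonic distance to the maximum -/
def YY (r : ℤ → ℝ) (k : ℤ) (d : ℕ) : ℝ := ∑ i ∈ Finset.range d, r (k + i)

lemma YY_zero (r : ℤ → ℝ) (k : ℤ) : YY r k 0 = 0 := by simp [YY]

lemma YY_succ (r : ℤ → ℝ) (k : ℤ) (d : ℕ) : YY r k (d + 1) = YY r (k + 1) d + r k := by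
  unfold YY
  rw [Finset.sum_range_succ']
  congr 1
  · apply Finset.sum_congr rfl
    intro i _
    congr 1
    push_cast; ring
  · simp

lemma GG_sum (p r : ℤ → ℝ) (κ C : ℝ) (hκ : 0 < κ) (hC : 0 < C) (h0 : ∀ k, κ ≤ p k)
    (h1 : ∀ k, p k ≤ 1 - κ) (hr0 : ∀ k, κ ≤ r k) (hr1 : ∀ k, r k ≤ C)
    (hpr : ∀ k, p k * r k = (1 - p k) * r (k - 1)) (l : ℝ) (hl : 0 < l) (N : ℕ) :
    ∀ k d, κ ^ 2 * ∑ K ∈ Finset.range N, GG p K k d ≤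
      (YY r k d ^ 2 + C ^ 2 * N) / (2 * l) + l / 2 - YY r k d := by
  induction N with
  | zero =>
    intro k d
    simp only [Finset.range_zero, Finset.sum_empty, mul_zero, Nat.cast_zero, add_zero]
    have : YY r k d ^ 2 / (2 * l) + l / 2 - YY r k d = (YY r k d - l) ^ 2 / (2 * l) := by
      field_simp; ring
    rw [this]; positivity
  | succ N ih =>
    intro k d
    rw [Finset.sum_range_succ']
    simp only [GG]
    rw [Finset.sum_add_distrib, ← Finset.mul_sum, ← Finset.mul_sum]
    have a1 := ih (k + 1) (d - 1)
    have a2 := ih (k - 1) (d + 1)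
    have e2 := YY_succ r (k - 1) d
    rw [sub_add_cancel] at e2
    have q0 : κ ≤ 1 - p k := by linarith [h1 k]
    have p0 := h0 k
    set X := ∑ K ∈ Finset.range N, GG p K (k + 1) (d - 1)
    set Z := ∑ K ∈ Finset.range N, GG p K (k - 1) (d + 1)
    have b1 := mul_le_mul_of_nonneg_left a1 (by linarith : 0 ≤ p k)
    have b2 := mul_le_mul_of_nonneg_left a2 (by linarith : 0 ≤ 1 - p k)
    rw [e2] at b2
    have hrk := hr0 k
    have hrk1 := hr0 (k - 1)
    have hrC := hr1 k
    have hrC1 := hr1 (k - 1)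
    have hpk := hpr k
    have s1 : r k ^ 2 ≤ C ^ 2 := pow_le_pow_left₀ (by linarith) hrC 2
    have s2 : r (k - 1) ^ 2 ≤ C ^ 2 := pow_le_pow_left₀ (by linarith) hrC1 2
    have hl2 : 0 < (2 * l)⁻¹ := by positivity
    simp only [div_eq_mul_inv] at b1 b2 ⊢
    set L := (2 * l)⁻¹
    push_cast
    rcases d with _ | d
    · simp only [Nat.zero_sub, YY_zero, if_true] at *
      have t1 : (1 - p k) * r (k - 1) ^ 2 ≤ C ^ 2 := by nlinarith
      have t2 := mul_le_mul_of_nonneg_right t1 hl2.le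
      have t3 : κ ^ 2 ≤ (1 - p k) * r (k - 1) := by nlinarith
      nlinarith
    · have e1 := YY_succ r k d
      simp only [Nat.add_sub_cancel, Nat.succ_ne_zero, if_false] at *
      have e1' : YY r (k + 1) d = YY r k (d + 1) - r k := by linarith
      rw [e1'] at b1
      set Y := YY r k (d + 1)
      have t1 : p k * r k ^ 2 + (1 - p k) * r (k - 1) ^ 2 ≤ C ^ 2 := by nlinarith
      have t2 := mul_le_mul_of_nonneg_right t1 hl2.le
      have t4 : L * Y * (p k * r k) = L * Y * ((1 - p k) * r (k - 1)) := by rw [hpk]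
      nlinarith

lemma GG_small (κ C : ℝ) (hκ : 0 < κ) (hC : 0 < C) (ε : ℝ) (hε : 0 < ε) :
    ∃ n : ℕ, 1 ≤ n ∧ ∀ p r : ℤ → ℝ, (∀ k, κ ≤ p k) → (∀ k, p k ≤ 1 - κ) →
      (∀ k, κ ≤ r k) → (∀ k, r k ≤ C) → (∀ k, p k * r k = (1 - p k) * r (k - 1)) →
      GG p n 0 0 < ε := by
  by_cases hκ1 : 1 - κ < κ
  · exact ⟨1, le_rfl, fun p r h0 h1 => absurd (h0 0) (by linarith [h1 0])⟩
  -- averaging scale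
  set l : ℝ := 4 * C ^ 2 / (κ ^ 2 * ε) with hl
  have hl0 : 0 < l := by positivity
  obtain ⟨N, hN⟩ := exists_nat_gt (2 * l / (κ ^ 2 * ε))
  have hN0 : (0 : ℝ) < N := lt_trans (by positivity) hN
  have hNpos : 1 ≤ N := by exact_mod_cast hN0
  have hδ : 0 < ε / (4 * N) := by positivity
  have hc1 : κ ^ 2 < 1 := by nlinarith
  obtain ⟨J, hJ⟩ := bdop_key (κ ^ 2) (by positivity) hc1 (ε / (4 * N)) hδ
  refine ⟨2 * J + 2 * N, by omega, fun p r h0 h1 hr0 hr1 hpr => ?_⟩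
  have h0' : ∀ k, 0 ≤ p k := fun k => by linarith [h0 k]
  have h1' : ∀ k, p k ≤ 1 := fun k => by linarith [h1 k]
  set T := QQ p ^ 2 with hT
  have hQ := QQ_bd p h0' h1'
  have hTbd : BdOp 1 T := hQ.pow 2
  set c := κ ^ 2 with hc
  have hc0 : 0 < c := by positivity
  have h1c : 0 < 1 - c := by linarith
  set R := (1 - c)⁻¹ • (T - c • (1 : Module.End ℝ (ℤ → ℝ))) with hR
  have hTR : c • (1 : Module.End ℝ (ℤ → ℝ)) + (1 - c) • R = T := by
    rw [hR, smul_smul, mul_inv_cancel₀ h1c.ne', one_smul]; abel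
  have hS : BdOp (1 - c) (T - c • (1 : Module.End ℝ (ℤ → ℝ))) := by
    intro φ M hM x
    have e : (T - c • (1 : Module.End ℝ (ℤ → ℝ))) φ x = QQ p (QQ p φ) x - c * φ x := rfl
    rw [e, QQ_apply, QQ_apply, QQ_apply, add_sub_cancel_right, sub_add_cancel]
    have b1 := abs_le.1 (hM (x + 1 + 1))
    have b2 := abs_le.1 (hM (x - 1 - 1))
    have b3 := abs_le.1 (hM x)
    have u1 : 0 ≤ p x * p (x + 1) := mul_nonneg (h0' _) (h0' _)
    have u2 : 0 ≤ (1 - p x) * (1 - p (x - 1)) :=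
      mul_nonneg (by linarith [h1' x]) (by linarith [h1' (x - 1)])
    have u3 : 0 ≤ p x * (1 - p (x + 1)) + (1 - p x) * p (x - 1) - c := by
      have v1 : κ * κ ≤ p x * (1 - p (x + 1)) :=
        mul_le_mul (h0 x) (by linarith [h1 (x + 1)]) hκ.le (h0' x)
      have v2 : 0 ≤ (1 - p x) * p (x - 1) := mul_nonneg (by linarith [h1' x]) (h0' _)
      rw [hc]; nlinarith
    have w1 := mul_le_mul_of_nonneg_left b1.1 u1
    have w2 := mul_le_mul_of_nonneg_left b1.2 u1
    have w3 := mul_le_mul_of_nonneg_left b2.1 u2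
    have w4 := mul_le_mul_of_nonneg_left b2.2 u2
    have w5 := mul_le_mul_of_nonneg_left b3.1 u3
    have w6 := mul_le_mul_of_nonneg_left b3.2 u3
    rw [abs_le]
    constructor <;> linarith
  have hRbd : BdOp 1 R := by
    have := hS.smul (inv_nonneg.2 h1c.le)
    rwa [inv_mul_cancel₀ h1c.ne'] at this
  have hJ1 := hJ R hRbd
  rw [hTR] at hJ1
  have hT1 : 1 - T = (1 - c) • (1 - R) := by
    rw [← hTR, smul_sub, sub_smul, one_smul]; abel
  have hJ2 : BdOp (ε / (4 * N)) (T ^ J * (1 - T)) := by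
    rw [hT1, mul_smul_comm]
    exact (hJ1.smul h1c.le).mono (by nlinarith)
  have hdiff : ∀ i : ℕ, BdOp (i * (ε / (4 * N))) (T ^ (J + i) - T ^ J) := by
    intro i
    induction i with
    | zero => intro φ M hM x; simp
    | succ i ih =>
      have e : T ^ (J + (i + 1)) - T ^ J
          = (T ^ (J + i) - T ^ J) + -(T ^ i * (T ^ J * (1 - T))) := by
        rw [← mul_assoc, ← pow_add, mul_sub, mul_one, ← pow_succ, ← add_assoc, add_comm i J]
        abel
      rw [e]
      refine (ih.add ((hTbd.pow i).mul hJ2).neg).mono ?_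
      push_cast; linarith
  set Φ : ℕ → ℤ → ℝ := fun K k => GG p K k 0 with hΦ
  have hΦ1 : ∀ K k, |Φ K k| ≤ 1 := fun K k => by
    rw [abs_of_nonneg (GG_nonneg p h0' h1' K k 0)]; exact GG_le_one p h0' h1' K k 0
  have hstep : ∀ i ∈ Finset.range N, GG p (2 * J + 2 * N) 0 0 ≤ (T ^ J) (Φ (2 * i)) 0 + ε / 4 := by
    intro i hi
    have hi' : i < N := Finset.mem_range.1 hi
    have a := GG_markov p h0' h1' (2 * i) (2 * (J + (N - i))) 0 0
    rw [show 2 * (J + (N - i)) + 2 * i = 2 * J + 2 * N by omega, pow_mul] at a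
    have b := hdiff (N - i) (Φ (2 * i)) 1 (hΦ1 _) 0
    have e : (T ^ (J + (N - i)) - T ^ J) (Φ (2 * i)) 0
      = (T ^ (J + (N - i))) (Φ (2 * i)) 0 - (T ^ J) (Φ (2 * i)) 0 := rfl
    rw [e] at b
    have b' := (abs_le.1 b).2
    have c1 : ((N - i : ℕ) : ℝ) ≤ N := by exact_mod_cast Nat.sub_le _ _
    have c2 : ((N - i : ℕ) : ℝ) * (ε / (4 * N)) ≤ N * (ε / (4 * N)) :=
      mul_le_mul_of_nonneg_right c1 hδ.le
    have c3 : (N : ℝ) * (ε / (4 * N)) = ε / 4 := by field_simp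
    linarith
  have hsum := Finset.sum_le_sum hstep
  rw [Finset.sum_const, Finset.card_range, nsmul_eq_mul, Finset.sum_add_distrib,
    Finset.sum_const, Finset.card_range, nsmul_eq_mul] at hsum
  set S : ℤ → ℝ := ∑ i ∈ Finset.range N, Φ (2 * i) with hSdef
  have eS : ∑ i ∈ Finset.range N, (T ^ J) (Φ (2 * i)) 0 = (T ^ J) S 0 := by
    rw [hSdef, map_sum, Finset.sum_apply]
  have hSbd : ∀ k, |S k| ≤ N * (ε / 2) := by
    intro k
    have e : S k = ∑ i ∈ Finset.range N, GG p (2 * i) k 0 := by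
      rw [hSdef, Finset.sum_apply]
    have n0 : 0 ≤ S k := by
      rw [e]; exact Finset.sum_nonneg fun i _ => GG_nonneg p h0' h1' _ _ _
    have n1 : S k ≤ ∑ K ∈ Finset.range (2 * N), GG p K k 0 := by
      rw [e, ← Finset.sum_image (f := fun K => GG p K k 0) (g := fun i => 2 * i)
        (fun a _ b _ h => by simpa using h)]
      apply Finset.sum_le_sum_of_subset_of_nonneg
      · intro K hK
        simp only [Finset.mem_image, Finset.mem_range] at hK ⊢
        omega
      · intro i _ _; exact GG_nonneg p h0' h1' _ _ _
    have n2 := GG_sum p r κ C hκ hC h0 h1 hr0 hr1 hpr l hl0 (2 * N) k 0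
    rw [YY_zero] at n2
    rw [abs_of_nonneg n0]
    have n3 : C ^ 2 * ((2 * N : ℕ) : ℝ) / (2 * l) = κ ^ 2 * (N * (ε / 4)) := by
      rw [hl]; push_cast; field_simp; ring
    have n4 : l / 2 ≤ κ ^ 2 * (N * (ε / 4)) := by
      rw [div_lt_iff₀ (by positivity)] at hN
      nlinarith
    have n5 : κ ^ 2 * ∑ K ∈ Finset.range (2 * N), GG p K k 0 ≤ κ ^ 2 * (N * (ε / 2)) := by
      have : (0 ^ 2 + C ^ 2 * ((2 * N : ℕ) : ℝ)) / (2 * l) = C ^ 2 * ((2 * N : ℕ) : ℝ) / (2 * l) := by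
        norm_num
      rw [this, n3] at n2
      linarith
    exact n1.trans (le_of_mul_le_mul_left n5 (by positivity))
  have fin := (abs_le.1 ((hTbd.pow J) S _ hSbd 0)).2
  rw [eS] at hsum
  have : (N : ℝ) * GG p (2 * J + 2 * N) 0 0 < N * ε := by nlinarith
  exact lt_of_mul_lt_mul_left this hN0.le

lemma walk_bound (𝔭 : UnitAddCircle → ℝ) (α : ℝ) (x : UnitAddCircle)
    (h0 : ∀ z, 0 ≤ 𝔭 z) (h1 : ∀ z, 𝔭 z ≤ 1)
    (Ω : Type) [MeasurableSpace Ω] (ℙ : Measure Ω) (ξ : ℕ → Ω → ℤ)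
    (hw : IsQPWalk 𝔭 α x 0 ℙ ξ) (n : ℕ) (s : ℕ) :
    ∀ (i : ℕ) (_ : i + s = n) (k : ℕ → ℤ) (d : ℕ) (_ : ∃ j ≤ i, k j = k i + d),
      ℙ ({ω | ∀ j ≤ i, ξ j ω = k j} ∩ {ω | ∀ j ≤ n, ξ j ω ≤ ξ n ω}) ≤
        ℙ {ω | ∀ j ≤ i, ξ j ω = k j} *
          ENNReal.ofReal (GG (fun k => 𝔭 (pt α x k)) s (k i) d) := by
  induction s with
  | zero =>
    intro i hi k d hd
    obtain rfl : i = n := by omega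
    by_cases h : d = 0
    · simp only [GG, h, if_true, ENNReal.ofReal_one, mul_one]
      exact measure_mono Set.inter_subset_left
    · obtain ⟨j, hj, hk⟩ := hd
      have : ({ω | ∀ j ≤ i, ξ j ω = k j} ∩ {ω | ∀ j ≤ i, ξ j ω ≤ ξ i ω}) = ∅ := by
        ext ω
        simp only [Set.mem_inter_iff, Set.mem_setOf_eq, Set.mem_empty_iff_false, iff_false]
        rintro ⟨a, b⟩
        have := b j hj
        rw [a j hj, a i le_rfl] at this
        omega
      rw [this]; simp
  | succ s ih =>
    intro i hi k d hd
    set E := {ω | ∀ j ≤ n, ξ j ω ≤ ξ n ω}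
    set kk : ℤ → ℕ → ℤ := fun v j => if j ≤ i then k j else v with hkk
    have hev : ∀ v, {ω | ∀ j ≤ i + 1, ξ j ω = kk v j}
        = {ω | ∀ j ≤ i, ξ j ω = k j} ∩ {ω | ξ (i + 1) ω = v} := by
      intro v
      ext ω
      simp only [Set.mem_inter_iff, Set.mem_setOf_eq, hkk]
      constructor
      · intro h
        refine ⟨fun j hj => ?_, ?_⟩
        · have := h j (by omega); rwa [if_pos hj] at this
        · have := h (i + 1) le_rfl; rwa [if_neg (by omega)] at this
      · rintro ⟨a, b⟩ j hj
        by_cases h : j ≤ i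
        · rw [if_pos h]; exact a j h
        · rw [if_neg h]
          obtain rfl : j = i + 1 := by omega
          exact b
    have hprob : ∀ v, ℙ {ω | ∀ j ≤ i + 1, ξ j ω = kk v j} =
        ℙ {ω | ∀ j ≤ i, ξ j ω = k j} * ENNReal.ofReal (stepProb 𝔭 α x (k i) v) := by
      intro v
      rw [hw.2.2, hw.2.2, Finset.prod_range_succ, ← mul_assoc, ENNReal.ofReal_mul]
      · congr 2
        · congr 1
          apply Finset.prod_congr rfl
          intro j hj
          have : j < i := Finset.mem_range.1 hj
          simp only [hkk]
          rw [if_pos (by omega), if_pos (by omega)]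
        · simp [hkk]
      · apply mul_nonneg
        · split_ifs <;> norm_num
        · apply Finset.prod_nonneg
          intro j _
          unfold stepProb
          split_ifs
          · exact h0 _
          · linarith [h1 (pt α x (kk v j))]
          · exact le_rfl
    have hkki : ∀ v, kk v (i + 1) = v := fun v => by simp [hkk]
    have hcover : ({ω | ∀ j ≤ i, ξ j ω = k j} ∩ E) ⊆
        (({ω | ∀ j ≤ i + 1, ξ j ω = kk (k i + 1) j} ∩ E) ∪
          ({ω | ∀ j ≤ i + 1, ξ j ω = kk (k i - 1) j} ∩ E)) ∪
        ⋃ v : {v : ℤ // v ≠ k i + 1 ∧ v ≠ k i - 1}, {ω | ∀ j ≤ i + 1, ξ j ω = kk v j} := by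
      intro ω hω
      simp only [hev]
      by_cases c1 : ξ (i + 1) ω = k i + 1
      · exact Or.inl (Or.inl ⟨⟨hω.1, c1⟩, hω.2⟩)
      by_cases c2 : ξ (i + 1) ω = k i - 1
      · exact Or.inl (Or.inr ⟨⟨hω.1, c2⟩, hω.2⟩)
      · exact Or.inr (Set.mem_iUnion.2 ⟨⟨_, c1, c2⟩, hω.1, rfl⟩)
    have hnull : ℙ (⋃ v : {v : ℤ // v ≠ k i + 1 ∧ v ≠ k i - 1},
        {ω | ∀ j ≤ i + 1, ξ j ω = kk v j}) = 0 := by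
      rw [measure_iUnion_null_iff]
      rintro ⟨v, hv1, hv2⟩
      rw [hprob]
      simp [stepProb, hv1, hv2]
    obtain ⟨j, hj, hjd⟩ := hd
    have i1 := ih (i + 1) (by omega) (kk (k i + 1)) (d - 1) (by
      rw [hkki]
      rcases Nat.eq_zero_or_pos d with hd0 | hd0
      · exact ⟨i + 1, le_rfl, by rw [hkki]; simp [hd0]⟩
      · refine ⟨j, by omega, ?_⟩
        simp only [hkk, if_pos hj, hjd]
        omega)
    have i2 := ih (i + 1) (by omega) (kk (k i - 1)) (d + 1) (by
      rw [hkki]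
      refine ⟨j, by omega, ?_⟩
      simp only [hkk, if_pos hj, hjd]
      push_cast; ring)
    rw [hkki, hprob] at i1 i2
    have st1 : stepProb 𝔭 α x (k i) (k i + 1) = 𝔭 (pt α x (k i)) := by simp [stepProb]
    have st2 : stepProb 𝔭 α x (k i) (k i - 1) = 1 - 𝔭 (pt α x (k i)) := by
      unfold stepProb
      rw [if_neg (by omega), if_pos rfl]
    rw [st1] at i1
    rw [st2] at i2
    have hg := GG_nonneg (fun k => 𝔭 (pt α x k)) (fun _ => h0 _) (fun _ => h1 _) s
    have q0 : 0 ≤ 1 - 𝔭 (pt α x (k i)) := by linarith [h1 (pt α x (k i))]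
    calc ℙ ({ω | ∀ j ≤ i, ξ j ω = k j} ∩ E) ≤ _ := measure_mono hcover
      _ ≤ _ := measure_union_le _ _
      _ ≤ _ := add_le_add (measure_union_le _ _) le_rfl
      _ ≤ _ := add_le_add (add_le_add i1 i2) hnull.le
      _ = _ := by
        simp only [GG]
        rw [add_zero, mul_assoc, mul_assoc, ← mul_add, ← ENNReal.ofReal_mul (h0 _),
          ← ENNReal.ofReal_mul q0, ← ENNReal.ofReal_add
            (mul_nonneg (h0 _) (hg _ _)) (mul_nonneg q0 (hg _ _))]

lemma walk_bound0 (𝔭 : UnitAddCircle → ℝ) (α : ℝ) (x : UnitAddCircle)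
    (h0 : ∀ z, 0 ≤ 𝔭 z) (h1 : ∀ z, 𝔭 z ≤ 1)
    (Ω : Type) [MeasurableSpace Ω] (ℙ : Measure Ω) (ξ : ℕ → Ω → ℤ)
    (hw : IsQPWalk 𝔭 α x 0 ℙ ξ) (n : ℕ) :
    (ℙ {ω | ∀ j ≤ n, ξ j ω ≤ ξ n ω}).toReal ≤ GG (fun k => 𝔭 (pt α x k)) n 0 0 := by
  have hP := hw.1
  have a := walk_bound 𝔭 α x h0 h1 Ω ℙ ξ hw n n 0 (by omega) (fun _ => 0) 0 ⟨0, le_rfl, by simp⟩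
  have b : ℙ {ω | ∀ j ≤ 0, ξ j ω = (fun _ : ℕ => (0 : ℤ)) j} = 1 := by
    rw [hw.2.2]; simp
  have hm : MeasurableSet {ω | ∀ j ≤ 0, ξ j ω = (fun _ : ℕ => (0 : ℤ)) j} := by
    have : {ω | ∀ j ≤ 0, ξ j ω = (fun _ : ℕ => (0 : ℤ)) j} = ξ 0 ⁻¹' {0} := by
      ext ω; simp
    rw [this]; exact hw.2.1 0 (measurableSet_singleton _)
  have c : ℙ {ω | ∀ j ≤ 0, ξ j ω = (fun _ : ℕ => (0 : ℤ)) j}ᶜ = 0 :=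
    (prob_compl_eq_zero_iff hm).2 b
  rw [Set.inter_comm, measure_inter_conull c, b, one_mul] at a
  exact ENNReal.toReal_le_of_le_ofReal
    (GG_nonneg _ (fun _ => h0 _) (fun _ => h1 _) n _ _) a

lemma coboundary (α : ℝ) (hα : Irrational α) (N : ℕ) (c d : ℕ → ℝ) :
    ∃ (g : ℝ → ℝ) (B : ℝ), (∀ t, |g t| ≤ B) ∧ ∀ t, g t - g (t - α) =
      ∑ k ∈ Finset.range N,
      (c k * Real.cos (2 * Real.pi * ((k : ℝ) + 1) * t) +
        d k * Real.sin (2 * Real.pi * ((k : ℝ) + 1) * t)) := by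
  have hs : ∀ k : ℕ, Real.sin (Real.pi * ((k : ℝ) + 1) * α) ≠ 0 := by
    intro k hk
    obtain ⟨z, hz⟩ := Real.sin_eq_zero_iff.1 hk
    have : ((k : ℝ) + 1) * α = z := by
      have hpi := Real.pi_ne_zero
      apply mul_left_cancel₀ hpi
      linarith
    have h2 : Irrational (((k + 1 : ℕ) : ℝ) * α) := hα.natCast_mul (by omega)
    apply h2
    exact ⟨(z : ℚ), by push_cast; linarith⟩
  refine ⟨fun t => ∑ k ∈ Finset.range N, (2 * Real.sin (Real.pi * ((k : ℝ) + 1) * α))⁻¹ *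
      (c k * Real.sin (2 * Real.pi * ((k : ℝ) + 1) * t + Real.pi * ((k : ℝ) + 1) * α)
        - d k * Real.cos (2 * Real.pi * ((k : ℝ) + 1) * t + Real.pi * ((k : ℝ) + 1) * α)),
    ∑ k ∈ Finset.range N, |(2 * Real.sin (Real.pi * ((k : ℝ) + 1) * α))⁻¹| *
      (|c k| + |d k|), ?_, ?_⟩
  · intro t
    refine (Finset.abs_sum_le_sum_abs _ _).trans (Finset.sum_le_sum fun k _ => ?_)
    rw [abs_mul]
    refine mul_le_mul_of_nonneg_left ?_ (abs_nonneg _)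
    refine (abs_sub _ _).trans ?_
    rw [abs_mul, abs_mul]
    exact add_le_add (mul_le_of_le_one_right (abs_nonneg _) (Real.abs_sin_le_one _))
      (mul_le_of_le_one_right (abs_nonneg _) (Real.abs_cos_le_one _))
  · intro t
    simp only
    rw [← Finset.sum_sub_distrib]
    apply Finset.sum_congr rfl
    intro k _
    have e : 2 * Real.pi * ((k : ℝ) + 1) * (t - α) + Real.pi * ((k : ℝ) + 1) * α
      = 2 * Real.pi * ((k : ℝ) + 1) * t - Real.pi * ((k : ℝ) + 1) * α := by ring
    rw [e, Real.sin_add, Real.sin_sub, Real.cos_add, Real.cos_sub]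
    have := hs k
    field_simp
    ring

/-- every zero-mean trigonometric polynomial `𝔣` belongs to `A_m` for
every `m ≥ 1`: there exists `n ≥ 1` such that `ℙ_x(max_{j≤n} ξ_j = ξ_n) < 1/m` for all
`x ∈ 𝕋`, where `(ξ_n)` is the walk in the environment `(𝔭, α, x)`,
`𝔭 = e^𝔣/(1+e^𝔣)`. -/
theorem statement15 (α : ℝ) (hα : Irrational α) (𝔣 : UnitAddCircle → ℝ)
    (h𝔣 : IsZeroMeanTrigPoly 𝔣) (m : ℕ) (hm : 1 ≤ m) :
    ∃ n : ℕ, 1 ≤ n ∧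
      ∀ (x : UnitAddCircle) (Ω : Type) [MeasurableSpace Ω] (ℙ : Measure Ω)
        (ξ : ℕ → Ω → ℤ), IsQPWalk (pOf 𝔣) α x 0 ℙ ξ →
        (ℙ {ω | ∀ j ≤ n, ξ j ω ≤ ξ n ω}).toReal < 1 / (m : ℝ) := by
  obtain ⟨N, c, d, hf⟩ := h𝔣
  obtain ⟨g, B, hgB, hg⟩ := coboundary α hα N c d
  have hB0 : 0 ≤ B := (abs_nonneg _).trans (hgB 0)
  have hfg : ∀ t : ℝ, 𝔣 (t : UnitAddCircle) = g t - g (t - α) := fun t => by rw [hf, hg]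
  have hfB : ∀ z : UnitAddCircle, |𝔣 z| ≤ 2 * B := by
    intro z
    induction z using QuotientAddGroup.induction_on with
    | H t =>
      have := hfg t
      have h1 := abs_le.1 (hgB t)
      have h2 := abs_le.1 (hgB (t - α))
      change |𝔣 (t : UnitAddCircle)| ≤ _
      rw [this, abs_le]
      constructor <;> linarith
  set κ : ℝ := Real.exp (-(2 * B)) / 2 with hκ
  have hκ0 : 0 < κ := by positivity
  have hp0 : ∀ z, κ ≤ pOf 𝔣 z := by
    intro z
    have h := abs_le.1 (hfB z)
    unfold pOf
    have e1 : Real.exp (-(2 * B)) ≤ Real.exp (𝔣 z) := Real.exp_le_exp.2 h.1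
    have e2 : Real.exp (-(2 * B)) ≤ 1 := Real.exp_le_one_iff.2 (by linarith)
    have e3 := Real.exp_pos (𝔣 z)
    rw [le_div_iff₀ (by positivity), hκ]
    nlinarith
  have hp1 : ∀ z, pOf 𝔣 z ≤ 1 - κ := by
    intro z
    have h := abs_le.1 (hfB z)
    unfold pOf
    have e1 : Real.exp (-(2 * B)) * Real.exp (𝔣 z) ≤ 1 := by
      rw [← Real.exp_add]; exact Real.exp_le_one_iff.2 (by linarith)
    have e2 : Real.exp (-(2 * B)) ≤ 1 := Real.exp_le_one_iff.2 (by linarith)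
    have e3 := Real.exp_pos (𝔣 z)
    rw [div_le_iff₀ (by positivity), hκ]
    nlinarith
  have hm0 : (0 : ℝ) < 1 / (m : ℝ) := by
    have : (0 : ℝ) < m := by exact_mod_cast hm
    positivity
  obtain ⟨n, hn, H⟩ := GG_small κ (Real.exp B) hκ0 (Real.exp_pos _) (1 / (m : ℝ)) hm0
  refine ⟨n, hn, fun x Ω _ ℙ ξ hw => ?_⟩
  refine (walk_bound0 (pOf 𝔣) α x (fun z => hκ0.le.trans (hp0 z))
    (fun z => (hp1 z).trans (by linarith)) Ω ℙ ξ hw n).trans_lt ?_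
  obtain ⟨t, rfl⟩ := QuotientAddGroup.mk_surjective x
  refine H _ (fun k => Real.exp (-g (t + k * α))) (fun k => hp0 _) (fun k => hp1 _) ?_ ?_ ?_
  · intro k
    have h := abs_le.1 (hgB (t + k * α))
    have : Real.exp (-(2 * B)) ≤ Real.exp (-g (t + k * α)) := Real.exp_le_exp.2 (by linarith)
    have := Real.exp_pos (-(2 * B))
    simp only [hκ]; linarith
  · intro k
    have h := abs_le.1 (hgB (t + k * α))
    exact Real.exp_le_exp.2 (by linarith)
  · intro k
    have e : 𝔣 (pt α (QuotientAddGroup.mk t) k) = g (t + k * α) - g (t + k * α - α) :=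
      hfg (t + k * α)
    have e2 : t + ((k - 1 : ℤ) : ℝ) * α = t + k * α - α := by push_cast; ring
    simp only [e2, pOf, e]
    have e3 := Real.exp_pos (g (t + k * α) - g (t + k * α - α))
    have e4 : Real.exp (-g (t + k * α - α)) =
        Real.exp (g (t + k * α) - g (t + k * α - α)) * Real.exp (-g (t + k * α)) := by
      rw [← Real.exp_add]; congr 1; ring
    rw [e4]
    field_simp
    ring
end
end

section
/- Let 𝔣 be continuous of bounded variation with ∫_𝕋 𝔣(x) dx = 0, let 𝔭(x) = e^{𝔣(x)}/(1+e^{𝔣(x)}), and set ζ_n = ξ_{2n}. Then for every t ∈ (0,1) and every ε > 0 there exists n₀ such that t^n / ℙ_x(ζ_n = 0) < ε for every x ∈ 𝕋 and every n ≥ n₀. -/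
open MeasureTheory Filter Finset

noncomputable section

attribute [local instance] Classical.propDecidable

lemma weyl_fourier (α : ℝ) (hα : Irrational α) (m : ℤ) (hm : m ≠ 0) :
    (fourier m (α : UnitAddCircle) : ℂ) ≠ 1 := by
  intro h
  rw [fourier_coe_apply, Complex.exp_eq_one_iff] at h
  obtain ⟨k, hk⟩ := h
  have h2 : (2 * (Real.pi : ℂ) * Complex.I) ≠ 0 := Complex.two_pi_I_ne_zero
  have h3 : ((m : ℂ) * α) = k := by
    apply mul_left_cancel₀ h2
    rw [mul_comm _ (k : ℂ), ← hk]; push_cast; ring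
  have h4 : (m : ℝ) * α = k := by exact_mod_cast h3
  exact (hα.intCast_mul hm) ⟨k, by rw [h4]; simp⟩

def UBirk (α : ℝ) (g : C(UnitAddCircle, ℂ)) : Prop :=
  ∀ η : ℝ, 0 < η → ∃ C : ℝ, ∀ (x : UnitAddCircle) (n : ℕ),
    ‖∑ j ∈ Finset.range n, g (pt α x j) - n * ∫ z : UnitAddCircle, g z‖ ≤ η * n + C

lemma int_cont (g : C(UnitAddCircle, ℂ)) : Integrable (fun z => g z) (volume : Measure UnitAddCircle) :=
  g.continuous.integrable_of_hasCompactSupport (HasCompactSupport.of_compactSpace _)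

lemma ubirk_fourier (α : ℝ) (hα : Irrational α) (m : ℤ) : UBirk α (fourier m) := by
  intro η hη
  by_cases hm : m = 0
  · subst hm
    refine ⟨0, fun x n => ?_⟩
    have : (∫ z : UnitAddCircle, (1 : ℂ)) = 1 := by
      rw [integral_const, measureReal_def, UnitAddCircle.measure_univ]; simp
    simp [this]
    positivity
  · have hne := weyl_fourier α hα m hm
    set e : ℂ := fourier m (α : UnitAddCircle) with he
    have hne' : e - 1 ≠ 0 := sub_ne_zero.2 hne
    have hI : ∫ z : UnitAddCircle, fourier m z = 0 := by
      have h1 := integral_add_right_eq_self (μ := (volume : Measure UnitAddCircle))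
        (fun z => (fourier m z : ℂ)) (α : UnitAddCircle)
      simp only [fourier_apply, smul_add, AddCircle.toCircle_add, Circle.coe_mul] at h1
      rw [integral_mul_const] at h1
      have h2 : (∫ z : UnitAddCircle, fourier m z) * (e - 1) = 0 := by
        simp only [he, fourier_apply]
        rw [mul_sub, h1]; ring
      exact (mul_eq_zero.1 h2).resolve_right hne'
    have hpt : ∀ (x : UnitAddCircle) (j : ℕ), (fourier m (pt α x j) : ℂ) = fourier m x * e ^ j := by
      intro x j
      have : pt α x j = x + j • (α : UnitAddCircle) := by
        simp [pt]
      rw [this]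
      simp only [he, fourier_apply, smul_add, AddCircle.toCircle_add, Circle.coe_mul]
      rw [smul_comm, AddCircle.toCircle_nsmul]; simp
    have hn1 : ‖e‖ = 1 := by rw [he, fourier_apply]; exact Circle.norm_coe _
    refine ⟨2 / ‖e - 1‖, fun x n => ?_⟩
    rw [hI, mul_zero, sub_zero, Finset.sum_congr rfl (fun j _ => hpt x j), ← Finset.mul_sum,
      geom_sum_eq hne, norm_mul, norm_div]
    have hx : ‖(fourier m x : ℂ)‖ = 1 := by rw [fourier_apply]; exact Circle.norm_coe _
    rw [hx, one_mul]
    have : ‖e ^ n - 1‖ ≤ 2 := by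
      refine (norm_sub_le _ _).trans ?_
      rw [norm_pow, hn1]; norm_num
    have h0 : 0 ≤ η * n := by positivity
    have : ‖e ^ n - 1‖ / ‖e - 1‖ ≤ 2 / ‖e - 1‖ := by gcongr
    linarith

lemma ubirk_all (α : ℝ) (hα : Irrational α) (g : C(UnitAddCircle, ℂ)) : UBirk α g := by
  have hspan : ∀ h ∈ Submodule.span ℂ (Set.range (fourier (T := (1:ℝ)))), UBirk α h := by
    intro h hh
    induction hh using Submodule.span_induction with
    | mem x hx => obtain ⟨m, rfl⟩ := hx; exact ubirk_fourier α hα m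
    | zero => intro η hη; exact ⟨0, fun x n => by simp; positivity⟩
    | add u v _ _ hu hv =>
      intro η hη
      obtain ⟨C, hC⟩ := hu (η/2) (by positivity)
      obtain ⟨D, hD⟩ := hv (η/2) (by positivity)
      refine ⟨C + D, fun x n => ?_⟩
      have : ∑ j ∈ Finset.range n, (u + v) (pt α x j) - n * ∫ z : UnitAddCircle, (u + v) z
        = (∑ j ∈ Finset.range n, u (pt α x j) - n * ∫ z : UnitAddCircle, u z) +
          (∑ j ∈ Finset.range n, v (pt α x j) - n * ∫ z : UnitAddCircle, v z) := by
        simp only [ContinuousMap.add_apply]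
        rw [Finset.sum_add_distrib, integral_add (int_cont u) (int_cont v)]; ring
      rw [this]
      have := norm_add_le_of_le (hC x n) (hD x n)
      linarith
    | smul a u _ hu =>
      intro η hη
      obtain ⟨C, hC⟩ := hu (η/(‖a‖+1)) (by positivity)
      refine ⟨‖a‖ * C, fun x n => ?_⟩
      have : ∑ j ∈ Finset.range n, (a • u) (pt α x j) - n * ∫ z : UnitAddCircle, (a • u) z
        = a * (∑ j ∈ Finset.range n, u (pt α x j) - n * ∫ z : UnitAddCircle, u z) := by
        simp only [ContinuousMap.smul_apply, smul_eq_mul]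
        rw [← Finset.mul_sum, integral_const_mul]; ring
      rw [this, norm_mul]
      have h1 := mul_le_mul_of_nonneg_left (hC x n) (norm_nonneg a)
      have h2 : ‖a‖ * (η / (‖a‖ + 1)) ≤ η := by
        rw [mul_div_assoc', div_le_iff₀ (by positivity)]
        nlinarith [norm_nonneg a]
      have h3 : ‖a‖ * (η / (‖a‖ + 1)) * n ≤ η * n := by gcongr
      nlinarith
  intro η hη
  have hg : g ∈ (Submodule.span ℂ (Set.range (fourier (T := (1:ℝ))))).topologicalClosure := by
    rw [span_fourier_closure_eq_top]; trivial
  rw [← SetLike.mem_coe, Submodule.topologicalClosure_coe, Metric.mem_closure_iff] at hg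
  obtain ⟨h, hh, hd⟩ := hg (η/3) (by positivity)
  obtain ⟨C, hC⟩ := hspan h hh (η/3) (by positivity)
  have hpw : ∀ z, ‖g z - h z‖ ≤ η/3 := fun z => by
    rw [← dist_eq_norm]; exact (ContinuousMap.dist_apply_le_dist z).trans hd.le
  refine ⟨C, fun x n => ?_⟩
  have e1 : ∑ j ∈ Finset.range n, g (pt α x j) - n * ∫ z : UnitAddCircle, g z
      = (∑ j ∈ Finset.range n, h (pt α x j) - n * ∫ z : UnitAddCircle, h z) +
        (∑ j ∈ Finset.range n, (g (pt α x j) - h (pt α x j))) -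
          n * ∫ z : UnitAddCircle, (g z - h z) := by
    rw [integral_sub (int_cont g) (int_cont h), Finset.sum_sub_distrib]; ring
  have e2 : ‖∑ j ∈ Finset.range n, (g (pt α x j) - h (pt α x j))‖ ≤ n * (η/3) := by
    refine (norm_sum_le_of_le _ (fun j _ => hpw _)).trans ?_
    simp
  have e3 : ‖∫ z : UnitAddCircle, (g z - h z)‖ ≤ η/3 := by
    have := norm_integral_le_of_norm_le_const (μ := (volume : Measure UnitAddCircle))
      (Filter.Eventually.of_forall hpw)
    rwa [measureReal_def, UnitAddCircle.measure_univ, ENNReal.toReal_one, mul_one] at this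
  have e4 : ‖(n:ℂ) * ∫ z : UnitAddCircle, (g z - h z)‖ ≤ n * (η/3) := by
    rw [norm_mul, Complex.norm_natCast]; gcongr
  rw [e1]
  have := norm_sub_le_of_le (norm_add_le_of_le (hC x n) e2) e4
  linarith

lemma ubirk_real (α : ℝ) (hα : Irrational α) (f : UnitAddCircle → ℝ) (hf : Continuous f)
    (h0 : ∫ z : UnitAddCircle, f z = 0) (η : ℝ) (hη : 0 < η) :
    ∃ C : ℝ, ∀ (x : UnitAddCircle) (n : ℕ), |∑ j ∈ Finset.range n, f (pt α x j)| ≤ η * n + C := by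
  obtain ⟨C, hC⟩ := ubirk_all α hα ⟨fun z => (f z : ℂ), by fun_prop⟩ η hη
  refine ⟨C, fun x n => ?_⟩
  have := hC x n
  simp only [ContinuousMap.coe_mk] at this
  rw [integral_complex_ofReal, h0] at this
  simp only [Complex.ofReal_zero, mul_zero, sub_zero] at this
  rw [← Complex.ofReal_sum, Complex.norm_real] at this
  exact this

/-- potential -/
def pot (F : ℤ → ℝ) (z : ℤ) : ℝ :=
  if 0 ≤ z then ∑ i ∈ Finset.range z.toNat, F i else
    -∑ i ∈ Finset.range (-z).toNat, F (z + i)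

lemma pot_zero (F : ℤ → ℝ) : pot F 0 = 0 := by simp [pot]

lemma pot_succ (F : ℤ → ℝ) (z : ℤ) : pot F (z + 1) = pot F z + F z := by
  rcases lt_trichotomy z (-1) with h | h | h
  · obtain ⟨k, rfl⟩ : ∃ k : ℕ, z = -(k + 1 + 1 : ℕ) := ⟨(-z).toNat - 2, by omega⟩
    rw [pot, pot, if_neg (by omega), if_neg (by omega)]
    rw [show (-(-((k + 1 + 1 : ℕ) : ℤ) + 1)).toNat = k + 1 by omega,
      show (-(-((k + 1 + 1 : ℕ) : ℤ))).toNat = k + 1 + 1 by omega, Finset.sum_range_succ' _ (k+1)]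
    simp only [Nat.cast_zero, add_zero]
    have : ∀ i ∈ Finset.range (k+1), F (-((k + 1 + 1 : ℕ) : ℤ) + 1 + i) =
        F (-((k + 1 + 1 : ℕ) : ℤ) + ((i + 1 : ℕ) : ℤ)) := by
      intro i _; congr 1; push_cast; ring
    rw [Finset.sum_congr rfl this]; ring
  · subst h; simp [pot]
  · obtain ⟨k, rfl⟩ : ∃ k : ℕ, z = k := ⟨z.toNat, by omega⟩
    rw [pot, pot, if_pos (by omega), if_pos (by omega)]
    rw [show ((k : ℤ) + 1).toNat = k + 1 by omega, Int.toNat_natCast, Finset.sum_range_succ]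

lemma pt_pt (α : ℝ) (x : UnitAddCircle) (a b : ℤ) : pt α (pt α x a) b = pt α x (a + b) := by
  simp only [pt]
  rw [add_assoc, ← AddCircle.coe_add]; congr 2; push_cast; ring

lemma pot_bound (α : ℝ) (f : UnitAddCircle → ℝ) (η C : ℝ)
    (hC : ∀ (x : UnitAddCircle) (n : ℕ), |∑ j ∈ Finset.range n, f (pt α x j)| ≤ η * n + C)
    (x : UnitAddCircle) (z : ℤ) : pot (fun j => f (pt α x j)) z ≤ η * z.natAbs + C := by
  rw [pot]
  split_ifs with h
  · have := hC x z.toNat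
    rw [show z.natAbs = z.toNat by omega]
    exact (le_abs_self _).trans this
  · have := hC (pt α x z) (-z).toNat
    simp only [pt_pt] at this
    rw [show z.natAbs = (-z).toNat by omega]
    exact (neg_le_abs _).trans this

/-- one step operator -/
def opP (p : ℤ → ℝ) (g : ℤ → ℝ) (a : ℤ) : ℝ := p a * g (a + 1) + (1 - p a) * g (a - 1)

def un (p : ℤ → ℝ) (n : ℕ) : ℤ → ℝ := (opP p)^[n] (fun a => if a = 0 then 1 else 0)

lemma un_succ (p : ℤ → ℝ) (n : ℕ) : un p (n+1) = opP p (un p n) := by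
  simp only [un, Function.iterate_succ_apply']

lemma un_supp (p : ℤ → ℝ) (n : ℕ) : ∀ a : ℤ, n < a.natAbs → un p n a = 0 := by
  induction n with
  | zero => intro a ha; simp only [un, Function.iterate_zero, id]; rw [if_neg]; omega
  | succ n ih =>
    intro a ha
    rw [un_succ, opP, ih _ (by omega), ih _ (by omega)]; ring

lemma un_nonneg (p : ℤ → ℝ) (h0 : ∀ a, 0 ≤ p a) (h1 : ∀ a, p a ≤ 1) (n : ℕ) :
    ∀ a : ℤ, 0 ≤ un p n a := by
  induction n with
  | zero => intro a; simp only [un, Function.iterate_zero, id]; split_ifs <;> norm_num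
  | succ n ih =>
    intro a
    rw [un_succ, opP]
    have := ih (a+1)
    have := ih (a-1)
    have := h0 a
    have : 0 ≤ 1 - p a := by linarith [h1 a]
    positivity

lemma un_fin (p : ℤ → ℝ) (n : ℕ) : (Function.support (un p n)).Finite := by
  refine (Set.finite_Icc (-(n:ℤ)) n).subset ?_
  intro a ha
  by_contra hc
  apply ha
  apply un_supp
  rw [Set.mem_Icc] at hc
  omega

lemma self_adj (p w : ℤ → ℝ) (hw : ∀ a, w a * p a = w (a+1) * (1 - p (a+1))) (g h : ℤ → ℝ)
    (hh : (Function.support h).Finite) :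
    ∑' a, w a * g a * opP p h a = ∑' a, w a * opP p g a * h a := by
  have S : ∀ k : ℤ → ℝ, Summable (fun a => k a * h a) := fun k =>
    summable_of_hasFiniteSupport (hh.subset (by intro a ha hc; simp [hc] at ha))
  have S1 : ∀ k : ℤ → ℝ, Summable (fun a => k a * h (a+1)) := fun k => by
    have := (Equiv.addRight (1:ℤ)).summable_iff.2 (S (fun a => k (a-1)))
    simpa [Function.comp_def] using this
  have S2 : ∀ k : ℤ → ℝ, Summable (fun a => k a * h (a-1)) := fun k => by
    have := (Equiv.addRight (-1:ℤ)).summable_iff.2 (S (fun a => k (a+1)))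
    simpa [Function.comp_def, ← sub_eq_add_neg] using this
  have T1 : ∑' a, (w a * g a * p a) * h (a+1) = ∑' a, (w (a-1) * g (a-1) * p (a-1)) * h a := by
    have := (Equiv.addRight (1:ℤ)).tsum_eq (fun a => (w (a-1) * g (a-1) * p (a-1)) * h a)
    simpa using this
  have T2 : ∑' a, (w a * g a * (1 - p a)) * h (a-1)
      = ∑' a, (w (a+1) * g (a+1) * (1 - p (a+1))) * h a := by
    have := (Equiv.addRight (-1:ℤ)).tsum_eq (fun a => (w (a+1) * g (a+1) * (1 - p (a+1))) * h a)
    simpa [← sub_eq_add_neg] using this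
  calc ∑' a, w a * g a * opP p h a
      = ∑' a, ((w a * g a * p a) * h (a+1) + (w a * g a * (1 - p a)) * h (a-1)) := by
        congr 1; ext a; rw [opP]; ring
    _ = ∑' a, (w (a-1) * g (a-1) * p (a-1)) * h a
        + ∑' a, (w (a+1) * g (a+1) * (1 - p (a+1))) * h a := by
        rw [(S1 _).tsum_add (S2 _), T1, T2]
    _ = ∑' a, w a * opP p g a * h a := by
        rw [← (S _).tsum_add (S _)]
        congr 1; ext a; rw [opP]
        have e1 := hw a
        have e2 := hw (a-1)
        rw [sub_add_cancel] at e2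
        linear_combination h a * g (a-1) * e2 - h a * g (a+1) * e1

lemma mass (p w : ℤ → ℝ) (hw : ∀ a, w a * p a = w (a+1) * (1 - p (a+1))) (n : ℕ) :
    ∑' a, w a * un p n a = w 0 := by
  induction n with
  | zero => simp [un]
  | succ n ih =>
    have := self_adj p w hw (fun _ => 1) (un p n) (un_fin p n)
    rw [un_succ]
    simpa [opP, ih] using this

lemma twice (p w : ℤ → ℝ) (hw : ∀ a, w a * p a = w (a+1) * (1 - p (a+1))) (n m : ℕ) :
    ∑' a, w a * un p n a * un p m a = w 0 * un p (n + m) 0 := by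
  induction m generalizing n with
  | zero => simp [un]
  | succ m ih =>
    rw [un_succ, self_adj p w hw _ _ (un_fin p m), ← un_succ, ih]
    congr 2; ring

lemma tsum_un (p : ℤ → ℝ) (n : ℕ) (k : ℤ → ℝ) :
    ∑' a, k a * un p n a = ∑ a ∈ Finset.Icc (-(n:ℤ)) n, k a * un p n a := by
  apply tsum_eq_sum
  intro a ha
  rw [un_supp, mul_zero]
  rw [Finset.mem_Icc] at ha; omega

lemma ret_lower (p w : ℤ → ℝ) (h0 : ∀ a, 0 ≤ p a) (h1 : ∀ a, p a ≤ 1)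
    (hw : ∀ a, w a * p a = w (a+1) * (1 - p (a+1))) (hw0 : ∀ a, 0 ≤ w a) (n : ℕ) (B : ℝ)
    (hB : ∀ a : ℤ, a.natAbs ≤ n → w a ≤ B) :
    w 0 ^ 2 ≤ (2 * n + 1) * B * (w 0 * un p (2 * n) 0) := by
  rw [two_mul n, ← twice p w hw]
  nth_rewrite 1 [← mass p w hw n]
  rw [tsum_un, tsum_un]
  refine sq_sum_le_card_mul_sum_sq.trans ?_
  have hc : ((Finset.Icc (-(n:ℤ)) n).card : ℝ) = 2 * n + 1 := by
    rw [Int.card_Icc]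
    rw [show ((n:ℤ) + 1 - -(n:ℤ)).toNat = 2 * n + 1 by omega]; push_cast; ring
  rw [hc, mul_assoc]
  refine mul_le_mul_of_nonneg_left ?_ (by positivity)
  rw [Finset.mul_sum]
  refine (Finset.sum_le_sum fun a ha => ?_)
  rw [Finset.mem_Icc] at ha
  have := hB a (by omega)
  have h2 := un_nonneg p h0 h1 n a
  have h3 := hw0 a
  calc (w a * un p n a)^2 = w a * (w a * un p n a * un p n a) := by ring
    _ ≤ B * (w a * un p n a * un p n a) := by gcongr

lemma walk_lower (𝔭 : UnitAddCircle → ℝ) (α : ℝ) (x : UnitAddCircle)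
    (h0 : ∀ z, 0 ≤ 𝔭 z) (h1 : ∀ z, 𝔭 z ≤ 1) (Ω : Type) [MeasurableSpace Ω] (ℙ : Measure Ω)
    (ξ : ℕ → Ω → ℤ) (hq : IsQPWalk 𝔭 α x 0 ℙ ξ) (m : ℕ) : ∀ (n : ℕ) (k : ℕ → ℤ),
    ENNReal.ofReal (((if k 0 = 0 then (1 : ℝ) else 0) *
        ∏ i ∈ Finset.range n, stepProb 𝔭 α x (k i) (k (i + 1))) *
          un (fun j => 𝔭 (pt α x j)) m (k n)) ≤
      ℙ ({ω | ∀ i ≤ n, ξ i ω = k i} ∩ {ω | ξ (n + m) ω = 0}) := by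
  obtain ⟨_, hmeas, hfd⟩ := hq
  have hs : ∀ a b, 0 ≤ stepProb 𝔭 α x a b := by
    intro a b
    rw [stepProb]; split_ifs
    · exact h0 _
    · linarith [h1 (pt α x a)]
    · rfl
  have hsing : ∀ n (c : ℤ), MeasurableSet {ω | ξ n ω = c} := fun n c =>
    hmeas n (measurableSet_singleton c)
  have hpath : ∀ n (k : ℕ → ℤ), MeasurableSet {ω | ∀ i ≤ n, ξ i ω = k i} := by
    intro n k
    simp only [Set.setOf_forall]
    exact MeasurableSet.iInter fun i => MeasurableSet.iInter fun _ => hsing i _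
  have hun := un_nonneg (fun j => 𝔭 (pt α x j)) (fun _ => h0 _) (fun _ => h1 _)
  induction m with
  | zero =>
    intro n k
    by_cases hk : k n = 0
    · have : {ω | ∀ i ≤ n, ξ i ω = k i} ∩ {ω | ξ (n + 0) ω = 0} = {ω | ∀ i ≤ n, ξ i ω = k i} := by
        apply Set.inter_eq_left.2
        intro ω hω
        have := hω n le_rfl
        simp only [Set.mem_setOf_eq, add_zero, this, hk]
      rw [this, hfd]
      simp [un, hk]
    · simp [un, hk]
  | succ m ih =>
    intro n k
    set A : ℝ := (if k 0 = 0 then (1 : ℝ) else 0) *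
        ∏ i ∈ Finset.range n, stepProb 𝔭 α x (k i) (k (i + 1)) with hA
    have hA0 : 0 ≤ A := by
      apply mul_nonneg
      · split_ifs <;> norm_num
      · exact Finset.prod_nonneg fun i _ => hs _ _
    have key : ∀ c : ℤ, ENNReal.ofReal (A * stepProb 𝔭 α x (k n) c *
        un (fun j => 𝔭 (pt α x j)) m c) ≤
        ℙ (({ω | ∀ i ≤ n, ξ i ω = k i} ∩ {ω | ξ (n + (m + 1)) ω = 0}) ∩ {ω | ξ (n+1) ω = c}) := by
      intro c
      have h := ih (n+1) (fun i => if i ≤ n then k i else c)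
      have hprod : ∏ i ∈ Finset.range (n+1), stepProb 𝔭 α x (if i ≤ n then k i else c)
          (if i + 1 ≤ n then k (i+1) else c) =
          (∏ i ∈ Finset.range n, stepProb 𝔭 α x (k i) (k (i + 1))) * stepProb 𝔭 α x (k n) c := by
        rw [Finset.prod_range_succ]
        congr 1
        · apply Finset.prod_congr rfl
          intro i hi
          rw [Finset.mem_range] at hi
          rw [if_pos (by omega), if_pos (by omega)]
        · rw [if_pos le_rfl, if_neg (by omega)]
      simp only [hprod] at h
      rw [if_pos (Nat.zero_le n), if_neg (by omega : ¬ n + 1 ≤ n), ← mul_assoc, ← hA] at h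
      refine h.trans (measure_mono ?_)
      rintro ω ⟨hω, hω2⟩
      simp only [Set.mem_setOf_eq] at hω hω2
      refine ⟨⟨fun i hi => ?_, ?_⟩, ?_⟩
      · have := hω i (by omega)
        rwa [if_pos hi] at this
      · simp only [Set.mem_setOf_eq]; rw [← hω2]; congr 1; omega
      · have := hω (n+1) le_rfl
        rwa [if_neg (by omega)] at this
    have k1 := key (k n + 1)
    have k2 := key (k n - 1)
    rw [stepProb, if_pos rfl] at k1
    rw [stepProb, if_neg (by omega), if_pos rfl] at k2
    set E := {ω | ∀ i ≤ n, ξ i ω = k i} ∩ {ω | ξ (n + (m + 1)) ω = 0} with hE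
    have hEm : MeasurableSet E := (hpath n k).inter (hsing _ _)
    have hdis : Disjoint (E ∩ {ω | ξ (n+1) ω = k n + 1}) (E ∩ {ω | ξ (n+1) ω = k n - 1}) := by
      rw [Set.disjoint_left]
      rintro ω ⟨_, ha⟩ ⟨_, hb⟩
      simp only [Set.mem_setOf_eq] at ha hb
      omega
    have hu : ℙ (E ∩ {ω | ξ (n+1) ω = k n + 1}) + ℙ (E ∩ {ω | ξ (n+1) ω = k n - 1}) ≤ ℙ E := by
      rw [← measure_union hdis (hEm.inter (hsing _ _))]
      exact measure_mono (Set.union_subset Set.inter_subset_left Set.inter_subset_left)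
    refine le_trans ?_ ((add_le_add k1 k2).trans hu)
    have q0 := h0 (pt α x (k n))
    have q1 : 0 ≤ 1 - 𝔭 (pt α x (k n)) := by linarith [h1 (pt α x (k n))]
    rw [← ENNReal.ofReal_add (mul_nonneg (mul_nonneg hA0 q0) (hun _ _))
      (mul_nonneg (mul_nonneg hA0 q1) (hun _ _))]
    apply ENNReal.ofReal_le_ofReal
    rw [un_succ, opP]
    apply le_of_eq; ring

lemma walk_ret (𝔭 : UnitAddCircle → ℝ) (α : ℝ) (x : UnitAddCircle)
    (h0 : ∀ z, 0 ≤ 𝔭 z) (h1 : ∀ z, 𝔭 z ≤ 1) (Ω : Type) [MeasurableSpace Ω] (ℙ : Measure Ω)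
    (ξ : ℕ → Ω → ℤ) (hq : IsQPWalk 𝔭 α x 0 ℙ ξ) (m : ℕ) :
    un (fun j => 𝔭 (pt α x j)) m 0 ≤ (ℙ {ω | ξ m ω = 0}).toReal := by
  have h := walk_lower 𝔭 α x h0 h1 Ω ℙ ξ hq m 0 (fun _ => 0)
  haveI := hq.1
  simp only [if_true, Finset.range_zero, Finset.prod_empty, one_mul, zero_add] at h
  have h2 := h.trans (measure_mono Set.inter_subset_right)
  exact (ENNReal.ofReal_le_iff_le_toReal (measure_ne_top _ _)).1 h2

/-- Lemma A.0: let `ζ_n = ξ_{2n}`. For every `t ∈ (0,1)` and `ε > 0`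
there is `n₀` such that `t^n / ℙ_x(ζ_n = 0) < ε` for every `x ∈ 𝕋` and `n ≥ n₀`:
the return probabilities decay slower than any exponential, uniformly in `x`. -/
theorem statement16 (α : ℝ) (hα : Irrational α) (𝔣 : UnitAddCircle → ℝ)
    (h𝔣 : ZeroMeanBV 𝔣) (t : ℝ) (ht : t ∈ Set.Ioo (0 : ℝ) 1) (ε : ℝ) (hε : 0 < ε) :
    ∃ n₀ : ℕ, ∀ (x : UnitAddCircle) (Ω : Type) [MeasurableSpace Ω] (ℙ : Measure Ω)
      (ξ : ℕ → Ω → ℤ), IsQPWalk (pOf 𝔣) α x 0 ℙ ξ →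
      ∀ n : ℕ, n₀ ≤ n → t ^ n / (ℙ {ω | ξ (2 * n) ω = 0}).toReal < ε := by
  obtain ⟨hc, -, hint⟩ := h𝔣
  obtain ⟨ht0, ht1⟩ := ht
  have hlog : Real.log t < 0 := Real.log_neg ht0 ht1
  set η := -Real.log t / 2 with hη
  have hηp : 0 < η := by rw [hη]; linarith
  obtain ⟨C, hC⟩ := ubirk_real α hα 𝔣 hc hint η hηp
  obtain ⟨M, hM⟩ : ∃ M, ∀ z, 𝔣 z ≤ M := by
    obtain ⟨z, -, hz⟩ := isCompact_univ.exists_isMaxOn Set.univ_nonempty hc.continuousOn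
    exact ⟨𝔣 z, fun y => hz (Set.mem_univ y)⟩
  have hp0 : ∀ z, 0 ≤ pOf 𝔣 z := fun z => by rw [pOf]; positivity
  have hp1 : ∀ z, pOf 𝔣 z ≤ 1 := fun z => by
    rw [pOf, div_le_one (by positivity)]; linarith
  set K : ℝ := (1 + Real.exp M) * Real.exp C with hK
  have hKp : 0 < K := by positivity
  set r : ℝ := t * Real.exp η with hr
  have hr0 : 0 < r := by positivity
  have hr1 : r < 1 := by
    rw [hr]; nth_rewrite 1 [← Real.exp_log ht0]
    rw [← Real.exp_add, Real.exp_lt_one_iff]; linarith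
  have hlim : Tendsto (fun n : ℕ => K * (2 * ((n : ℝ) * r ^ n) + r ^ n)) atTop (nhds 0) := by
    have a1 := tendsto_self_mul_const_pow_of_lt_one hr0.le hr1
    have a2 := tendsto_pow_atTop_nhds_zero_of_lt_one hr0.le hr1
    have := ((a1.const_mul 2).add a2).const_mul K
    simpa using this
  obtain ⟨n₀, hn₀⟩ := (hlim.eventually (gt_mem_nhds hε)).exists_forall_of_atTop
  refine ⟨n₀, fun x Ω _ ℙ ξ hq n hn => ?_⟩
  refine lt_of_le_of_lt ?_ (hn₀ n hn)
  set p : ℤ → ℝ := fun j => pOf 𝔣 (pt α x j) with hp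
  set F : ℤ → ℝ := fun j => 𝔣 (pt α x j) with hF
  set w : ℤ → ℝ := fun a => (1 + Real.exp (F a)) * Real.exp (pot F a) with hw
  have hrev : ∀ a, w a * p a = w (a+1) * (1 - p (a+1)) := by
    intro a
    have e1 : p a = Real.exp (F a) / (1 + Real.exp (F a)) := rfl
    have e2 : p (a+1) = Real.exp (F (a+1)) / (1 + Real.exp (F (a+1))) := rfl
    rw [e1, e2]
    simp only [hw]
    rw [pot_succ, Real.exp_add]
    have g1 : 1 + Real.exp (F a) ≠ 0 := by positivity
    have g2 : 1 + Real.exp (F (a+1)) ≠ 0 := by positivity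
    field_simp
    ring
  have hB : ∀ a : ℤ, a.natAbs ≤ n → w a ≤ K * Real.exp η ^ n := by
    intro a ha
    have b1 := pot_bound α 𝔣 η C hC x a
    have b2 : pot F a ≤ n * η + C := by
      have : η * (a.natAbs : ℝ) ≤ η * n := by gcongr
      linarith
    have b3 : F a ≤ M := hM _
    calc w a ≤ (1 + Real.exp M) * Real.exp (n * η + C) := by simp only [hw]; gcongr
      _ = K * Real.exp η ^ n := by rw [Real.exp_add, Real.exp_nat_mul]; ring
  have hmain := ret_lower p w (fun _ => hp0 _) (fun _ => hp1 _) hrev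
    (fun a => by simp only [hw]; positivity) n _ hB
  have hw0 : 1 ≤ w 0 := by
    simp only [hw, pot_zero, Real.exp_zero, mul_one]; linarith [Real.exp_pos (F 0)]
  have hu : un p (2 * n) 0 ≤ (ℙ {ω | ξ (2 * n) ω = 0}).toReal :=
    walk_ret (pOf 𝔣) α x hp0 hp1 Ω ℙ ξ hq (2 * n)
  set R := (ℙ {ω | ξ (2 * n) ω = 0}).toReal with hR
  have hfin : 1 ≤ (2 * n + 1) * (K * Real.exp η ^ n) * R := by
    have : w 0 * w 0 ≤ w 0 * ((2 * n + 1) * (K * Real.exp η ^ n) * un p (2 * n) 0) := by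
      calc w 0 * w 0 = w 0 ^ 2 := by ring
        _ ≤ _ := hmain
        _ = _ := by ring
    have h5 := le_of_mul_le_mul_left this (by linarith)
    refine (hw0.trans h5).trans ?_
    gcongr
  have hRp : 0 < R := by
    by_contra hcon
    have : R ≤ 0 := not_lt.1 hcon
    have h6 : 0 ≤ (2 * (n:ℝ) + 1) * (K * Real.exp η ^ n) := by positivity
    nlinarith
  rw [div_le_iff₀ hRp]
  calc t ^ n = t ^ n * 1 := by ring
    _ ≤ t ^ n * ((2 * n + 1) * (K * Real.exp η ^ n) * R) := by gcongr
    _ = _ := by rw [hr, mul_pow]; ring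
end
end
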